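/- arXiv:1804.07109 — 3 statements merged into one kernel-verified Lean document; each statement's English description precedes it below -/
import Mathlib

section
/- Every solution of the Fermat quartic over the 8-th cyclotomic field is cuspidal: for all x, y, z in the cyclotomic field ℚ(ζ₈) (the 8-th cyclotomic extension of ℚ), if x⁴ + y⁴ = z⁴ then x·y·z = 0. -/
theorem aux_sq_pos {a b c : ℤ} (h : Int.gcd a b = 1) (heq : a * b = c ^ 2) (ha : 0 ≤ a) :
    ∃ d : ℤ, a = d ^ 2 := by
  obtain ⟨d, hd | hd⟩ := Int.sq_of_gcd_eq_one h heq
  · exact ⟨d, hd⟩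
  · exact ⟨0, by nlinarith [sq_nonneg d]⟩

/-- the last step of the descent -/
theorem aux_step {p q k l : ℤ} (hq : q ≠ 0) (hk : 0 ≤ k) (hl : 0 ≤ l) (hkl : Int.gcd k l = 1)
    (h1 : q ^ 2 = 2 * k * l) (h2 : p ^ 2 = k ^ 2 + l ^ 2) (hk2 : k % 2 = 0) :
    ∃ s t : ℤ, s ≠ 0 ∧ t ≠ 0 ∧ s ^ 4 + 4 * t ^ 4 = p ^ 2 := by
  obtain ⟨k1, rfl⟩ : (2 : ℤ) ∣ k := Int.dvd_of_emod_eq_zero hk2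
  have hq2 : (2 : ℤ) ∣ q := Int.prime_two.dvd_of_dvd_pow (n := 2) ⟨2 * k1 * l, by rw [h1]; ring⟩
  obtain ⟨q1, rfl⟩ := hq2
  have h3 : k1 * l = q1 ^ 2 := by linarith
  have hg : Int.gcd k1 l = 1 := by
    rw [← Int.isCoprime_iff_gcd_eq_one] at *
    exact hkl.of_mul_left_right
  obtain ⟨g, rfl⟩ := aux_sq_pos hg h3 (by linarith)
  obtain ⟨h, rfl⟩ := aux_sq_pos (by rwa [Int.gcd_comm]) ((mul_comm _ _).trans h3) hl
  refine ⟨h, g, ?_, ?_, by rw [h2]; ring⟩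
  · rintro rfl
    apply hq
    have : q1 ^ 2 = 0 := by rw [← h3]; ring
    simpa using this
  · rintro rfl
    apply hq
    have : q1 ^ 2 = 0 := by rw [← h3]; ring
    simpa using this

theorem no_four (n : ℕ) : ∀ s t c : ℤ, c.natAbs = n → s ≠ 0 → t ≠ 0 →
    s ^ 4 + 4 * t ^ 4 ≠ c ^ 2 := by
  induction n using Nat.strong_induction_on with
  | _ n ih =>
  intro s t c hc hs ht h
  have hc0 : c ≠ 0 := by
    rintro rfl
    have : 0 < s ^ 4 := by positivity
    have : 0 < t ^ 4 := by positivity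
    linarith
  by_cases hg : Int.gcd s t = 1
  swap
  · -- not coprime
    obtain ⟨g, hgd⟩ : ∃ g : ℤ, g = (Int.gcd s t : ℤ) := ⟨_, rfl⟩
    obtain ⟨s', hs'⟩ : g ∣ s := hgd ▸ Int.gcd_dvd_left ..
    obtain ⟨t', ht'⟩ : g ∣ t := hgd ▸ Int.gcd_dvd_right ..
    have hg0 : g ≠ 0 := by rintro rfl; simp at hs'; exact hs hs'
    have hdvd : (g ^ 2) ^ 2 ∣ c ^ 2 := ⟨s' ^ 4 + 4 * t' ^ 4, by rw [← h, hs', ht']; ring⟩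
    rw [Int.pow_dvd_pow_iff (by norm_num)] at hdvd
    obtain ⟨c', hc'⟩ := hdvd
    have hg1 : g.natAbs ≠ 1 := by rw [hgd]; simpa using hg
    have hg2 : g.natAbs ≠ 0 := by simpa using hg0
    have hc'0 : c' ≠ 0 := by rintro rfl; simp at hc'; exact hc0 hc'
    refine ih c'.natAbs ?_ s' t' c' rfl (by rintro rfl; simp at hs'; exact hs hs')
      (by rintro rfl; simp at ht'; exact ht ht') ?_
    · rw [← hc, hc', Int.natAbs_mul, Int.natAbs_pow]
      have : 0 < c'.natAbs := by positivity
      have h2 : 2 ≤ g.natAbs := by omega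
      have h3 : 2 ≤ g.natAbs ^ 2 := by nlinarith
      nlinarith
    · have : g ^ 4 * (s' ^ 4 + 4 * t' ^ 4) = g ^ 4 * c' ^ 2 := by
        subst hs'; subst ht'; subst hc'; linarith
      exact mul_left_cancel₀ (by positivity) this
  rcases Int.emod_two_eq_zero_or_one s with hs2 | hs2
  · obtain ⟨s', rfl⟩ : (2 : ℤ) ∣ s := Int.dvd_of_emod_eq_zero hs2
    obtain ⟨c', rfl⟩ : (2 : ℤ) ∣ c := Int.prime_two.dvd_of_dvd_pow (n := 2)
      ⟨8 * s' ^ 4 + 2 * t ^ 4, by rw [← h]; ring⟩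
    refine ih c'.natAbs ?_ t s' c' rfl ht (by rintro rfl; simp at hs) (by linarith)
    rw [← hc, Int.natAbs_mul]
    have : 0 < c'.natAbs := by
      have : c' ≠ 0 := by rintro rfl; simp at hc0
      positivity
    simp; omega
  have hcop : IsCoprime s t := Int.isCoprime_iff_gcd_eq_one.mpr hg
  have hs2' : IsCoprime s 2 := by
    refine ⟨1, - (s / 2), ?_⟩
    have := Int.emod_add_mul_ediv s 2
    linarith
  have hcop1 : IsCoprime (s ^ 2) (2 * t ^ 2) := (hs2'.mul_right (hcop.pow_right)).pow_left
  have hpt : PythagoreanTriple (s ^ 2) (2 * t ^ 2) |c| := by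
    unfold PythagoreanTriple
    rw [abs_mul_abs_self]; linarith
  obtain ⟨m, n', hm1, hm2, hm3, hm4, hm5, hm6⟩ := hpt.coprime_classification'
    (Int.isCoprime_iff_gcd_eq_one.mp hcop1) (by rw [pow_two, Int.mul_emod, hs2]; rfl)
    (abs_pos.mpr hc0)
  have hmn : m * n' = t ^ 2 := by linarith
  have htp : 0 < t ^ 2 := by positivity
  have hn0 : 0 ≤ n' := by
    by_contra hlt
    push Not at hlt
    nlinarith
  obtain ⟨p, rfl⟩ := aux_sq_pos hm4 hmn hm6
  obtain ⟨q, rfl⟩ := aux_sq_pos (by rwa [Int.gcd_comm]) ((mul_comm _ _).trans hmn) hn0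
  have hp0 : p ≠ 0 := by rintro rfl; apply ht; simpa using hmn.symm
  have hq0 : q ≠ 0 := by rintro rfl; apply ht; simpa using hmn.symm
  have hpq : IsCoprime (p ^ 2) (q ^ 2) := Int.isCoprime_iff_gcd_eq_one.mpr hm4
  have hsq : IsCoprime s (q ^ 2) := by
    have : IsCoprime (s ^ 2) (q ^ 2) := by
      rw [hm1]
      have h5 : IsCoprime ((p ^ 2) ^ 2) (q ^ 2) := hpq.pow_left
      have := h5.add_mul_right_left (-(q ^ 2))
      convert! this using 1; ring
    exact (IsCoprime.pow_left_iff (by norm_num)).mp this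
  have hpt2 : PythagoreanTriple s (q ^ 2) (p ^ 2) := by
    unfold PythagoreanTriple
    linarith
  obtain ⟨k, l, hk1, hk2, hk3, hk4, hk5, hk6⟩ := hpt2.coprime_classification'
    (Int.isCoprime_iff_gcd_eq_one.mp hsq) hs2 (by positivity)
  have hl0 : 0 ≤ l := by
    by_contra hlt
    push Not at hlt
    have : 0 < q ^ 2 := by positivity
    nlinarith
  have key : ∃ s t : ℤ, s ≠ 0 ∧ t ≠ 0 ∧ s ^ 4 + 4 * t ^ 4 = p ^ 2 := by
    rcases hk5 with ⟨h6, -⟩ | ⟨-, h6⟩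
    · exact aux_step hq0 hk6 hl0 hk4 hk2 hk3 h6
    · exact aux_step hq0 hl0 hk6 (by rwa [Int.gcd_comm]) (by rw [hk2]; ring) (by rw [hk3]; ring) h6
  obtain ⟨s1, t1, hs1, ht1, h7⟩ := key
  refine ih p.natAbs ?_ s1 t1 p rfl hs1 ht1 h7
  rw [← hc]
  zify
  rw [hm3]
  have h8 : 1 ≤ |p| := Int.one_le_abs hp0
  have h9 : 0 < q ^ 2 := by positivity
  have : p ^ 2 = |p| ^ 2 := (sq_abs p).symm
  rw [this]
  have h10 : |p| ≤ |p| ^ 2 := by nlinarith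
  have h11 : |p| ^ 2 ≤ (|p| ^ 2) ^ 2 := by nlinarith
  have h12 : 0 < (q ^ 2) ^ 2 := by positivity
  linarith

theorem rat_aux (C : ℤ) (H : ∀ s t c : ℤ, s ≠ 0 → t ≠ 0 → s ^ 4 + C * t ^ 4 ≠ c ^ 2)
    (u z : ℚ) (hu : u ≠ 0) : u ^ 4 + C ≠ z ^ 2 := by
  intro h
  have hd : (u.den : ℚ) ≠ 0 := by simp
  have he : (z.den : ℚ) ≠ 0 := by simp
  refine H (u.num * z.den) (u.den * z.den) (z.num * u.den ^ 2 * z.den) ?_ ?_ ?_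
  · simpa using hu
  · simp
  · qify
    have hu' := Rat.num_div_den u
    have hz' := Rat.num_div_den z
    rw [← hu', ← hz'] at h
    field_simp at h
    linear_combination (z.den : ℚ) ^ 2 * h

/-- `x³ - x = y²` has only trivial rational points -/
theorem rat_one (x y : ℚ) (h : y ^ 2 = x ^ 3 - x) : y = 0 := by
  by_contra hy
  have hx : x ≠ 0 := by rintro rfl; simp at h; exact hy h
  refine rat_aux 4 (fun s t c hs ht => no_four _ s t c rfl hs ht) (y / x) (x + 1 / x)
    (div_ne_zero hy hx) ?_
  rw [div_pow, show y ^ 4 = (x ^ 3 - x) ^ 2 by rw [← h]; ring]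
  push_cast
  field_simp
  ring

theorem rat_two (x y : ℚ) (h : 2 * y ^ 2 = x ^ 3 - x) : y = 0 := by
  by_contra hy
  have hx : x ≠ 0 := by rintro rfl; simp at h; exact hy h
  refine rat_aux 1 (fun s t c hs ht => by rw [one_mul]; exact not_fermat_42 hs ht)
    (y / x) ((x + 1 / x) / 2) (div_ne_zero hy hx) ?_
  rw [div_pow, show y ^ 4 = ((x ^ 3 - x) / 2) ^ 2 by rw [← h]; ring]
  push_cast
  field_simp
  ring
/-- The data of `ℚ(ζ₈)` which is used: two commuting involutions, `i = √-1` and `r = √2`. -/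
structure Setup (K : Type) [Field K] [Algebra ℚ K] where
  s : K →ₐ[ℚ] K
  t : K →ₐ[ℚ] K
  i : K
  r : K
  hi : i ^ 2 = -1
  hr : r ^ 2 = 2
  si : s i = -i
  sr : s r = -r
  ti : t i = i
  tr : t r = -r
  ss : ∀ x, s (s x) = x
  tt : ∀ x, t (t x) = x
  st : ∀ x, s (t x) = t (s x)
  fixed : ∀ x, s x = x → t x = x → ∃ q : ℚ, algebraMap ℚ K q = x

/-- the curve `y² = x³ - x` -/
def EC : WeierstrassCurve.Affine ℚ := ⟨0, 0, 0, -1, 0⟩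

open WeierstrassCurve.Affine in
theorem EC_a1 (K : Type) [Field K] [Algebra ℚ K] : (EC⁄K).a₁ = 0 := map_zero (algebraMap ℚ K)
open WeierstrassCurve.Affine in
theorem EC_a2 (K : Type) [Field K] [Algebra ℚ K] : (EC⁄K).a₂ = 0 := map_zero (algebraMap ℚ K)
open WeierstrassCurve.Affine in
theorem EC_a3 (K : Type) [Field K] [Algebra ℚ K] : (EC⁄K).a₃ = 0 := map_zero (algebraMap ℚ K)
open WeierstrassCurve.Affine in
theorem EC_a6 (K : Type) [Field K] [Algebra ℚ K] : (EC⁄K).a₆ = 0 := map_zero (algebraMap ℚ K)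
open WeierstrassCurve.Affine in
theorem EC_a4 (K : Type) [Field K] [Algebra ℚ K] : (EC⁄K).a₄ = -1 :=
  (map_neg (algebraMap ℚ K) 1).trans (by rw [map_one])

open WeierstrassCurve.Affine in
theorem EC_nonsing {K : Type} [Field K] [Algebra ℚ K] (x y : K) :
    (EC⁄K).Nonsingular x y ↔ y ^ 2 = x ^ 3 - x := by
  have : CharZero K := algebraRat.charZero K
  rw [nonsingular_iff', equation_iff']
  simp only [EC_a1, EC_a2, EC_a3, EC_a4, EC_a6]
  constructor
  · rintro ⟨h, -⟩
    linear_combination h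
  · intro h
    refine ⟨by linear_combination h, ?_⟩
    by_contra! hc
    obtain ⟨h1, h2⟩ := hc
    have hy : y = 0 := by
      have : 2 * y = 0 := by linear_combination h2
      simpa using this
    have h3 : 3 * x ^ 2 = 1 := by linear_combination -h1
    have h4 : x ^ 3 = x := by rw [hy] at h; linear_combination -h
    have : (2 : K) = 0 := by
      linear_combination (3 * x ^ 2 - 2) * h3 - 9 * x * h4
    norm_num at this

open WeierstrassCurve.Affine in
open Classical in
theorem EC_two {K : Type} [Field K] [Algebra ℚ K] (x y : K) (h : (EC⁄K).Nonsingular x y)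
    (hy : y = 0) : Point.some x y h + Point.some x y h = 0 := by
  apply Point.add_self_of_Y_eq
  rw [negY, EC_a1, EC_a3, hy]; simp

open WeierstrassCurve.Affine in
open Classical in
theorem EC_dbl {K : Type} [Field K] [Algebra ℚ K] (x y : K) (h : (EC⁄K).Nonsingular x y)
    (hy : y ≠ 0) : ∃ x' y' h', Point.some x y h + Point.some x y h = Point.some x' y' h' ∧
      x' = ((x ^ 2 + 1) / (2 * y)) ^ 2 := by
  have : CharZero K := algebraRat.charZero K
  have hE := (EC_nonsing x y).mp h
  have hne : y ≠ (EC⁄K).negY x y := by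
    simp only [negY, EC_a1, EC_a2, EC_a3, EC_a4, EC_a6]
    intro h1
    apply hy
    have : 2 * y = 0 := by linear_combination h1
    simpa using this
  refine ⟨_, _, _, Point.add_self_of_Y_ne hne, ?_⟩
  rw [slope_of_Y_ne rfl hne]
  simp only [addX, negY, EC_a1, EC_a2, EC_a3, EC_a4, EC_a6]
  have h2 : y - (-y - 0 * x - 0) = 2 * y := by ring
  rw [h2]
  field_simp
  linear_combination (-8 * x) * hE

/-- halving a two-torsion point or a four-torsion point -/
theorem sq_id {K : Type} [Field K] [CharZero K] (x y : K) (hy : y ≠ 0)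
    (h : y ^ 2 = x ^ 3 - x) :
    ((x ^ 2 + 1) / (2 * y)) ^ 2 - 1 = ((x ^ 2 - 2 * x - 1) / (2 * y)) ^ 2 ∧
    ((x ^ 2 + 1) / (2 * y)) ^ 2 + 1 = ((x ^ 2 + 2 * x - 1) / (2 * y)) ^ 2 := by
  constructor <;> field_simp
  · linear_combination (-4) * h
  · linear_combination (4) * h

namespace Setup
variable {K : Type} [Field K] [Algebra ℚ K]

theorem rat_im (S : Setup K) (d : ℚ) (hd : ∀ x y : ℚ, d * y ^ 2 = x ^ 3 - x → y = 0) (w x y : K) (hw : w ^ 2 = algebraMap ℚ K d)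
    (hw0 : w ≠ 0) (h : y ^ 2 = x ^ 3 - x) (hsx : S.s x = x) (htx : S.t x = x)
    (hsy : S.s (y / w) = y / w) (hty : S.t (y / w) = y / w) : y = 0 := by
  obtain ⟨q, rfl⟩ := S.fixed x hsx htx
  obtain ⟨p, hp⟩ := S.fixed _ hsy hty
  have hy : y = w * algebraMap ℚ K p := by rw [hp]; field_simp
  have : p = 0 := by
    apply hd q
    apply (algebraMap ℚ K).injective
    simp only [map_mul, map_sub, map_pow]
    rw [← hw, ← h, hy]; ring
  rw [hy, this]; simp

theorem i_ne (S : Setup K) : S.i ≠ 0 := by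
  have : CharZero K := algebraRat.charZero K
  intro h; have := S.hi; rw [h] at this; norm_num at this

theorem r_ne (S : Setup K) : S.r ≠ 0 := by
  have : CharZero K := algebraRat.charZero K
  intro h; have := S.hr; rw [h] at this; norm_num at this

theorem char_pt (S : Setup K) (x y a b : K) (ha : a = 1 ∨ a = -1) (hb : b = 1 ∨ b = -1)
    (h : y ^ 2 = x ^ 3 - x) (hsx : S.s x = x) (htx : S.t x = x)
    (hsy : S.s y = a * y) (hty : S.t y = b * y) : y = 0 := by
  have hi := S.i_ne
  have hr := S.r_ne
  rcases ha with rfl | rfl <;> rcases hb with rfl | rfl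
  · exact S.rat_im 1 (fun x y h => rat_one x y (by linarith)) 1 x y (by simp) one_ne_zero h hsx htx
      (by simpa using hsy) (by simpa using hty)
  · exact S.rat_im (-2) (fun x y h => rat_two (-x) y (by linarith)) (S.i * S.r) x y
      (by rw [mul_pow, S.hi, S.hr]; simp) (mul_ne_zero hi hr) h hsx htx
      (by rw [map_div₀, map_mul, S.si, S.sr, hsy]; field_simp)
      (by rw [map_div₀, map_mul, S.ti, S.tr, hty]; field_simp)
  · exact S.rat_im (-1) (fun x y h => rat_one (-x) y (by linarith)) (S.i) x y
      (by rw [S.hi]; simp) (hi) h hsx htx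
      (by rw [map_div₀, S.si, hsy]; field_simp)
      (by rw [map_div₀, S.ti, hty]; field_simp)
  · exact S.rat_im 2 (fun x y h => rat_two x y (by linarith)) (S.r) x y
      (by rw [S.hr]; simp) (hr) h hsx htx
      (by rw [map_div₀, S.sr, hsy]; field_simp)
      (by rw [map_div₀, S.tr, hty]; field_simp)

open WeierstrassCurve.Affine in
open Classical in
theorem pt_two (S : Setup K) (P : (EC⁄K).Point) (hs : Point.map S.s P = P ∨ Point.map S.s P = -P)
    (ht : Point.map S.t P = P ∨ Point.map S.t P = -P) : P + P = 0 := by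
  rcases P with _ | ⟨x, y, h⟩
  · exact add_zero _
  · apply EC_two
    have hE := (EC_nonsing x y).mp h
    rw [Point.map_some, Point.neg_some] at hs ht
    simp only [Point.some.injEq] at hs ht
    have hn : (EC⁄K).negY x y = - y := by
      rw [negY, EC_a1, EC_a3]; simp
    rw [hn] at hs ht
    have hsx : S.s x = x := by tauto
    have htx : S.t x = x := by tauto
    obtain ⟨a, ha, ha'⟩ : ∃ a : K, (a = 1 ∨ a = -1) ∧ S.s y = a * y := by
      rcases hs with ⟨-, h⟩ | ⟨-, h⟩
      · exact ⟨1, Or.inl rfl, by simpa using h⟩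
      · exact ⟨-1, Or.inr rfl, by simpa using h⟩
    obtain ⟨b, hb, hb'⟩ : ∃ a : K, (a = 1 ∨ a = -1) ∧ S.t y = a * y := by
      rcases ht with ⟨-, h⟩ | ⟨-, h⟩
      · exact ⟨1, Or.inl rfl, by simpa using h⟩
      · exact ⟨-1, Or.inr rfl, by simpa using h⟩
    exact S.char_pt x y a b ha hb hE hsx htx ha' hb'

open WeierstrassCurve.Affine in
open Classical in
theorem eight (S : Setup K) (P : (EC⁄K).Point) : (8 : ℕ) • P = 0 := by
  obtain ⟨A, hA⟩ : ∃ A, A = Point.map S.s P := ⟨_, rfl⟩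
  obtain ⟨B, hB⟩ : ∃ B, B = Point.map S.t P := ⟨_, rfl⟩
  obtain ⟨C, hC⟩ : ∃ C, C = Point.map S.s B := ⟨_, rfl⟩
  have e1 : Point.map S.s A = P := by
    rw [hA]; rcases P with _ | ⟨x, y, h⟩
    · rfl
    · simp only [Point.map_some, S.ss]
  have e2 : Point.map S.t B = P := by
    rw [hB]; rcases P with _ | ⟨x, y, h⟩
    · rfl
    · simp only [Point.map_some, S.tt]
  have e3 : Point.map S.t A = C := by
    rw [hA, hC, hB]; rcases P with _ | ⟨x, y, h⟩
    · rfl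
    · simp only [Point.map_some, S.st]
  have e4 : Point.map S.s C = B := by
    rw [hC]; rcases B with _ | ⟨x, y, h⟩
    · rfl
    · simp only [Point.map_some, S.ss]
  have e5 : Point.map S.t C = A := by
    rw [← e3]; rcases A with _ | ⟨x, y, h⟩
    · rfl
    · simp only [Point.map_some, S.tt]
  have h1 := S.pt_two (P + A + B + C) (by simp only [map_add, ← hA, e1, ← hC, e4]; left; abel)
    (by simp only [map_add, ← hB, e2, e3, e5]; left; abel)
  have h2 := S.pt_two (P + A - B - C) (by simp only [map_add, map_sub, ← hA, e1, ← hC, e4]; left; abel)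
    (by simp only [map_add, map_sub, ← hB, e2, e3, e5]; right; abel)
  have h3 := S.pt_two (P - A + B - C) (by simp only [map_add, map_sub, ← hA, e1, ← hC, e4]; right; abel)
    (by simp only [map_add, map_sub, ← hB, e2, e3, e5]; left; abel)
  have h4 := S.pt_two (P - A - B + C) (by simp only [map_add, map_sub, ← hA, e1, ← hC, e4]; right; abel)
    (by simp only [map_add, map_sub, ← hB, e2, e3, e5]; right; abel)
  have : (8 : ℕ) • P = ((P + A + B + C) + (P + A + B + C)) + ((P + A - B - C) + (P + A - B - C))
    + ((P - A + B - C) + (P - A + B - C)) + ((P - A - B + C) + (P - A - B + C)) := by abel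
  rw [this, h1, h2, h3, h4]; simp

/-- `2` and `-1` are not squares of elements fixed by `s`. -/
theorem norm_s (S : Setup K) (w v : K) (hv : w ^ 2 = v) : v * S.s v ≠ 2 ∧ v * S.s v ≠ -1 := by
  have : CharZero K := algebraRat.charZero K
  have hN : S.s (w * S.s w) = w * S.s w := by rw [map_mul, S.ss]; ring
  have hN2 : (w * S.s w) ^ 2 = v * S.s v := by rw [← hv, map_pow]; ring
  constructor
  · intro h
    rw [h, ← S.hr, sq_eq_sq_iff_eq_or_eq_neg] at hN2
    have : S.r = 0 := by
      have h2 : 2 * S.r = 0 := by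
        rcases hN2 with h1 | h1 <;> rw [h1] at hN
        · rw [S.sr] at hN; linear_combination -hN
        · rw [map_neg, S.sr] at hN; linear_combination hN
      simpa using h2
    exact S.r_ne this
  · intro h
    rw [h, ← S.hi, sq_eq_sq_iff_eq_or_eq_neg] at hN2
    have : S.i = 0 := by
      have h2 : 2 * S.i = 0 := by
        rcases hN2 with h1 | h1 <;> rw [h1] at hN
        · rw [S.si] at hN; linear_combination -hN
        · rw [map_neg, S.si] at hN; linear_combination hN
      simpa using h2
    exact S.i_ne this

theorem norm_t (S : Setup K) (w v : K) (hv : w ^ 2 = v) : v * S.t v ≠ -2 := by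
  have : CharZero K := algebraRat.charZero K
  have hN : S.t (w * S.t w) = w * S.t w := by rw [map_mul, S.tt]; ring
  have hN2 : (w * S.t w) ^ 2 = v * S.t v := by rw [← hv, map_pow]; ring
  intro h
  rw [h, show (-2 : K) = (S.i * S.r) ^ 2 by rw [mul_pow, S.hi, S.hr]; ring,
    sq_eq_sq_iff_eq_or_eq_neg] at hN2
  have : S.i * S.r = 0 := by
    have h2 : 2 * (S.i * S.r) = 0 := by
      rcases hN2 with h1 | h1 <;> rw [h1] at hN
      · rw [map_mul, S.ti, S.tr] at hN; linear_combination -hN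
      · rw [map_neg, map_mul, S.ti, S.tr] at hN; linear_combination hN
    simpa using h2
  exact mul_ne_zero S.i_ne S.r_ne this

/-- The `x`-coordinates of the points of order four. -/
def Four (x : K) : Prop := x ^ 2 = -1 ∨ (x - 1) ^ 2 = 2 ∨ (x + 1) ^ 2 = 2

theorem four_of_half (x y v : K) (hy : y ≠ 0) (h : y ^ 2 = x ^ 3 - x)
    (hv : v = ((x ^ 2 + 1) / (2 * y)) ^ 2) (hv' : v ^ 3 - v = 0) : Four x := by
  have : CharZero K := algebraRat.charZero K
  obtain ⟨h1, h2⟩ := sq_id x y hy h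
  have h3 : v * (v - 1) * (v + 1) = 0 := by linear_combination hv'
  rw [← hv] at h1 h2
  have hy2 : 2 * y ≠ 0 := by simpa using hy
  rcases mul_eq_zero.mp h3 with h3 | h3
  · rcases mul_eq_zero.mp h3 with h3 | h3
    · left
      rw [hv, pow_eq_zero_iff (by norm_num), div_eq_zero_iff] at h3
      have := h3.resolve_right hy2
      linear_combination this
    · right; left
      rw [h1, pow_eq_zero_iff (by norm_num), div_eq_zero_iff] at h3
      have := h3.resolve_right hy2
      linear_combination this
  · right; right
    rw [h2, pow_eq_zero_iff (by norm_num), div_eq_zero_iff] at h3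
    have := h3.resolve_right hy2
    linear_combination this

theorem four_cases (S : Setup K) (x : K) (h : Four x) : x = S.i ∨ x = -S.i ∨ x = 1 + S.r ∨ x = 1 - S.r ∨
    x = -1 + S.r ∨ x = -1 - S.r := by
  rcases h with h | h | h
  · rw [← S.hi, sq_eq_sq_iff_eq_or_eq_neg] at h
    tauto
  · rw [← S.hr, sq_eq_sq_iff_eq_or_eq_neg] at h
    rcases h with h | h
    · right; right; left; linear_combination h
    · right; right; right; left; linear_combination h
  · rw [← S.hr, sq_eq_sq_iff_eq_or_eq_neg] at h
    rcases h with h | h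
    · right; right; right; right; left; linear_combination h
    · right; right; right; right; right; linear_combination h

theorem not_half (S : Setup K) (x y v : K) (hy : y ≠ 0) (h : y ^ 2 = x ^ 3 - x)
    (hv : v = ((x ^ 2 + 1) / (2 * y)) ^ 2) : ¬ Four v := by
  have : CharZero K := algebraRat.charZero K
  intro h4
  obtain ⟨h1, h2⟩ := sq_id x y hy h
  rw [← hv] at h1 h2
  have n1 := S.norm_s _ _ hv.symm
  have n2 := S.norm_s _ _ h1.symm
  have hr := S.hr
  have hi := S.hi
  rcases S.four_cases v h4 with h | h | h | h | h | h
  · apply n2.1; rw [h, map_sub, map_one, S.si]; linear_combination -hi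
  · apply n2.1; rw [h, map_sub, map_one, map_neg, S.si]; linear_combination -hi
  all_goals
    apply n1.2; rw [h]; simp only [map_add, map_sub, map_neg, map_one, S.sr]; linear_combination -hr

open WeierstrassCurve.Affine in
open Classical in
theorem main_pt (S : Setup K) (x y : K) (hy : y ≠ 0) (h : y ^ 2 = x ^ 3 - x) : Four x := by
  have : CharZero K := algebraRat.charZero K
  obtain ⟨x1, y1, h1, e1, f1⟩ := EC_dbl x y ((EC_nonsing x y).mpr h) hy
  have g1 := (EC_nonsing x1 y1).mp h1
  by_cases hy1 : y1 = 0
  · exact four_of_half x y x1 hy h f1 (by rw [← g1, hy1]; simp)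
  obtain ⟨x2, y2, h2, e2, f2⟩ := EC_dbl x1 y1 h1 hy1
  have g2 := (EC_nonsing x2 y2).mp h2
  by_cases hy2 : y2 = 0
  · exact absurd (four_of_half x1 y1 x2 hy1 g1 f2 (by rw [← g2, hy2]; simp))
      (S.not_half x y x1 hy h f1)
  obtain ⟨x3, y3, h3, e3, f3⟩ := EC_dbl x2 y2 h2 hy2
  exfalso
  have := S.eight (Point.some x y ((EC_nonsing x y).mpr h))
  have e : ∀ P : (EC⁄K).Point, (8 : ℕ) • P = (P + P + (P + P)) + (P + P + (P + P)) := by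
    intro P; abel
  rw [e, e1, e2, e3] at this
  exact Point.some_ne_zero _ this

theorem fermat (S : Setup K) (x y z : K) (h : x ^ 4 + y ^ 4 = z ^ 4) : x * y * z = 0 := by
  have : CharZero K := algebraRat.charZero K
  by_contra h0
  have hx : x ≠ 0 := by rintro rfl; simp at h0
  have hy : y ≠ 0 := by rintro rfl; simp at h0
  have hz : z ≠ 0 := by rintro rfl; simp at h0
  obtain ⟨u, hu⟩ : ∃ u, u = x / y := ⟨_, rfl⟩
  obtain ⟨v, hv⟩ : ∃ v, v = z / y := ⟨_, rfl⟩
  have hu0 : u ≠ 0 := by rw [hu]; exact div_ne_zero hx hy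
  have hv0 : v ≠ 0 := by rw [hv]; exact div_ne_zero hz hy
  have huv : v ^ 4 = u ^ 4 + 1 := by rw [hu, hv]; field_simp; exact h.symm
  obtain ⟨w, hw⟩ : ∃ w, w = v ^ 2 + u ^ 2 := ⟨_, rfl⟩
  have hw1 : w * (v ^ 2 - u ^ 2) = 1 := by rw [hw]; linear_combination huv
  have hw0 : w ≠ 0 := by intro hw0; rw [hw0] at hw1; simp at hw1
  have key := S.main_pt w (S.r * u * w) (mul_ne_zero (mul_ne_zero S.r_ne hu0) hw0) (by
    rw [mul_pow, mul_pow, S.hr]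
    linear_combination (-w) * hw1 + (-w ^ 2) * hw)
  have hZ : 2 * v ^ 2 * w = w ^ 2 + 1 := by linear_combination (-w) * hw + hw1
  have hr := S.hr
  have hv2 : v ^ 2 = S.r ∨ v ^ 2 = - S.r := by
    rw [← sq_eq_sq_iff_eq_or_eq_neg, hr]
    have hZ2 : 4 * w ^ 2 * ((v ^ 2) ^ 2 - 2) = w ^ 4 - 6 * w ^ 2 + 1 := by
      linear_combination (2 * v ^ 2 * w + w ^ 2 + 1) * hZ
    have h5 : w ^ 4 - 6 * w ^ 2 + 1 = 0 := by
      rcases key with k | k | k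
      · exfalso
        have : 2 * v ^ 2 * w = 0 := by rw [hZ, k]; ring
        simp [hv0, hw0] at this
      · linear_combination (w ^ 2 + 2 * w - 1) * k
      · linear_combination (w ^ 2 - 2 * w - 1) * k
    rw [h5] at hZ2
    have h6 : (4 * w ^ 2 : K) ≠ 0 := by simpa using hw0
    have := (mul_eq_zero.mp hZ2).resolve_left h6
    linear_combination this
  have := S.norm_t v _ rfl
  apply this
  rcases hv2 with h | h <;> rw [h] <;> simp only [map_neg, S.tr] <;> linear_combination -hr

end Setup

open IsCyclotomicExtension in
theorem exists_setup (K : Type) [Field K] [Algebra ℚ K] [IsCyclotomicExtension {8} ℚ K] :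
    Nonempty (Setup K) := by
  have : NeZero ((8 : ℕ) : ℚ) := ⟨by norm_num⟩
  have hirr : Irreducible (Polynomial.cyclotomic 8 ℚ) :=
    Polynomial.cyclotomic.irreducible_rat (by norm_num)
  have hz := zeta_spec 8 ℚ K
  have h3 := hz.pow_of_coprime 3 (by norm_num)
  have h5 := hz.pow_of_coprime 5 (by norm_num)
  obtain ⟨s, e3⟩ : ∃ s : K →ₐ[ℚ] K, s (zeta 8 ℚ K) = zeta 8 ℚ K ^ 3 :=
    ⟨(fromZetaAut h3 hirr).toAlgHom, fromZetaAut_spec h3 hirr⟩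
  obtain ⟨t, e5⟩ : ∃ t : K →ₐ[ℚ] K, t (zeta 8 ℚ K) = zeta 8 ℚ K ^ 5 :=
    ⟨(fromZetaAut h5 hirr).toAlgHom, fromZetaAut_spec h5 hirr⟩
  have hfix : ∀ f : K →ₐ[ℚ] K,
      ∀ g : K →ₐ[ℚ] K,
      f (zeta 8 ℚ K) = g (zeta 8 ℚ K) → f = g := by
    intro f g h
    apply (hz.powerBasis ℚ).algHom_ext
    simpa using h
  generalize zeta 8 ℚ K = z at *
  have z8 : z ^ 8 = 1 := hz.pow_eq_one
  have z4 : z ^ 4 = -1 := by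
    have h : (z ^ 4 - 1) * (z ^ 4 + 1) = 0 := by linear_combination z8
    rcases mul_eq_zero.mp h with h | h
    · exact absurd (sub_eq_zero.mp h) (hz.pow_ne_one_of_pos_of_lt (by norm_num) (by norm_num))
    · linear_combination h
  have e5' : t z = -z := by rw [e5]; linear_combination z * z4
  have gal : IsGalois ℚ K := IsCyclotomicExtension.isGalois {8} ℚ K
  have fd : FiniteDimensional ℚ K := IsCyclotomicExtension.finiteDimensional {8} ℚ K
  refine ⟨⟨s, t, z ^ 2, z - z ^ 3, by linear_combination z4, ?_, ?_, ?_, ?_, ?_, ?_, ?_, ?_, ?_⟩⟩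
  · linear_combination (z ^ 2 - 2) * z4
  · simp only [map_pow, e3]; linear_combination z ^ 2 * z4
  · simp only [map_sub, map_pow, e3]; linear_combination (z - z ^ 5) * z4
  · simp only [map_pow, e5']; ring
  · simp only [map_sub, map_pow, e5']; ring
  · intro x
    have := hfix (s.comp s) (AlgHom.id ℚ _) (by
      simp only [AlgHom.comp_apply, AlgHom.id_apply, map_pow, e3]
      linear_combination z * z8)
    exact DFunLike.congr_fun this x
  · intro x
    have := hfix (t.comp t) (AlgHom.id ℚ _) (by
      simp only [AlgHom.comp_apply, AlgHom.id_apply, map_neg, e5']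
      ring)
    exact DFunLike.congr_fun this x
  · intro x
    have := hfix (s.comp t) (t.comp s) (by
      simp only [AlgHom.comp_apply, map_pow, map_neg, e3, e5']
      ring)
    exact DFunLike.congr_fun this x
  · intro x hs ht
    refine (IsGalois.mem_range_algebraMap_iff_fixed (F := ℚ) x).mpr ?_
    intro f
    have hf4 : (f z) ^ 4 = -1 := by rw [← map_pow, z4]; simp
    have hprod : (f z - z) * (f z + z) * ((f z - z ^ 3) * (f z + z ^ 3)) = 0 := by
      linear_combination hf4 - (f z ^ 2 * z ^ 2 - z ^ 4 + 1) * z4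
    have fin : ∀ g : K →ₐ[ℚ] K, g x = x → f z = g z → f x = x := by
      intro g hg h
      have := DFunLike.congr_fun (hfix (f : _ →ₐ[ℚ] _) g h) x
      exact this.trans hg
    rcases mul_eq_zero.mp hprod with h | h <;> rcases mul_eq_zero.mp h with h | h
    · exact fin (AlgHom.id ℚ _) rfl (by simp only [AlgHom.id_apply]; linear_combination h)
    · exact fin t ht (by simp only [e5']; linear_combination h)
    · exact fin s hs (by simp only [e3]; linear_combination h)
    · exact fin (t.comp s) (by simp [hs, ht])
        (by simp only [AlgHom.comp_apply, map_pow, e3, e5']; linear_combination h)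

/-- Every solution of the Fermat quartic `X⁴ + Y⁴ = Z⁴` over the 8-th cyclotomic
field `ℚ(ζ₈)` is cuspidal: `x⁴ + y⁴ = z⁴` implies `x·y·z = 0`. -/
theorem fermat_quartic_cyclotomic_eight_cuspidal
    (x y z : CyclotomicField 8 ℚ) (h : x ^ 4 + y ^ 4 = z ^ 4) :
    x * y * z = 0 := by
  have : NeZero ((8 : ℕ) : ℚ) := ⟨by norm_num⟩
  obtain ⟨S⟩ := @exists_setup _ _ _ (CyclotomicField.isCyclotomicExtension 8 ℚ)
  exact S.fermat x y z h
end

section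
/- The set of affine points of the Fermat quartic over the 8-th cyclotomic field has exactly 8 elements: the set {(x, y) ∈ K × K | x⁴ + y⁴ = 1}, where K is the 8-th cyclotomic field ℚ(ζ₈), has cardinality 8. -/
theorem fq_congr {a b c d : ℤ} (h1 : a = c) (h2 : b = d) : IsCoprime a b ↔ IsCoprime c d := by
  rw [h1, h2]

theorem fq_pow_mod (a n : ℤ) (k : ℕ) : a ^ k % n = (a % n) ^ k % n :=
  ((Int.mod_modEq a n).symm.pow k)

theorem fq_sqpos {a b c : ℤ} (ha : 0 < a) (h : IsCoprime a b) (e : a * b = c ^ 2) :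
    ∃ p, a = p ^ 2 := by
  obtain ⟨p, hp | hp⟩ := Int.sq_of_isCoprime h e
  · exact ⟨p, hp⟩
  · nlinarith [sq_nonneg p]

theorem fq_aux {u v p : ℤ} (huv : IsCoprime u v) (hv : v % 2 = 1) (hu : u ≠ 0)
    (e : p ^ 2 = 4 * u ^ 4 + v ^ 4) :
    ∃ f g : ℤ, IsCoprime f g ∧ g ≠ 0 ∧ f ^ 4 = g ^ 4 + v ^ 2 ∧ f.natAbs < p.natAbs := by
  have hu2 : 0 < u ^ 2 := by positivity
  have hp : p ≠ 0 := by
    rintro rfl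
    nlinarith [sq_nonneg (v^2)]
  have tr : PythagoreanTriple (v ^ 2) (2 * u ^ 2) |p| := by
    unfold PythagoreanTriple
    rw [abs_mul_abs_self]; linarith
  have hv2 : v ^ 2 % 2 = 1 := by
    rw [pow_two, Int.mul_emod, hv]; rfl
  have hco : Int.gcd (v ^ 2) (2 * u ^ 2) = 1 := by
    rw [← Int.isCoprime_iff_gcd_eq_one]
    refine IsCoprime.mul_right ?_ (huv.symm.pow)
    exact IsCoprime.pow_left ⟨1, -(v/2), by omega⟩
  obtain ⟨k, l, h1, h2, h3, h4, h5, h6⟩ := tr.coprime_classification' hco hv2 (abs_pos.mpr hp)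
  have hkl : k * l = u ^ 2 := by linarith
  have hk : 0 < k := by
    rcases h6.lt_or_eq with h | h
    · exact h
    · rw [← h] at hkl; linarith
  have hl : 0 < l := by
    by_contra hl
    nlinarith
  have hc : IsCoprime k l := Int.isCoprime_iff_gcd_eq_one.mpr h4
  obtain ⟨f, hf⟩ := fq_sqpos hk hc hkl
  obtain ⟨g, hg⟩ := fq_sqpos hl hc.symm (by linarith : l * k = u ^ 2)
  refine ⟨f, g, ?_, ?_, ?_, ?_⟩
  · rw [hf, hg] at hc
    exact (IsCoprime.pow_iff (by norm_num) (by norm_num)).mp hc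
  · rintro rfl; simp at hg; omega
  · rw [h1, hf, hg]; ring
  · zify
    rw [h3]
    have : |f| ≤ f ^ 2 := by
      rw [← sq_abs]
      nlinarith [abs_nonneg f, Int.one_le_abs (show f ≠ 0 by rintro rfl; simp at hf; omega)]
    nlinarith

theorem fq_L1 : ∀ N : ℕ, ∀ p q r : ℤ, p.natAbs = N → IsCoprime p q → q ≠ 0 → r ≠ 0 →
    p ^ 4 = q ^ 4 + r ^ 2 → False := by
  intro N
  induction N using Nat.strong_induction_on with
  | _ N ih =>
  intro p q r hN hpq hq hr e
  have hp : p ≠ 0 := by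
    rintro rfl
    have : 0 < r ^ 2 := by positivity
    have : 0 ≤ q ^ 4 := by positivity
    simp at e; omega
  have hqr : IsCoprime q r := by
    have : IsCoprime q (r ^ 2) := by
      have h : IsCoprime q (p ^ 4) := hpq.symm.pow_right
      rw [e] at h
      have := h.add_mul_left_right (-q^3)
      exact (fq_congr (by ring) (by ring)).mp this
    exact (IsCoprime.pow_right_iff (by norm_num)).mp this
  rcases Int.emod_two_eq_zero_or_one q with hq2 | hq2
  · have key : ∀ m n : ℤ, 0 < m → 0 < n → IsCoprime m n → m % 2 = 0 → n % 2 = 1 →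
        q ^ 2 = 2 * m * n → p ^ 2 = m ^ 2 + n ^ 2 → False := by
      intro m n hm hn hc hm2 hn2 e1 e2
      obtain ⟨m', rfl⟩ : (2:ℤ) ∣ m := Int.dvd_of_emod_eq_zero hm2
      obtain ⟨q', rfl⟩ : (2:ℤ) ∣ q := Int.dvd_of_emod_eq_zero hq2
      have hc' : IsCoprime m' n := hc.of_mul_left_right
      have e3 : m' * n = q' ^ 2 := by linarith
      obtain ⟨u, rfl⟩ := fq_sqpos (by linarith) hc' e3
      obtain ⟨v, rfl⟩ := fq_sqpos hn hc'.symm (by linarith : n * u ^ 2 = q' ^ 2)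
      have hv : v % 2 = 1 := by
        rcases Int.emod_two_eq_zero_or_one v with h | h
        · rw [pow_two, Int.mul_emod, h] at hn2; simp at hn2
        · exact h
      obtain ⟨f, g, a1, a2, a3, a4⟩ := fq_aux (p := p)
        ((IsCoprime.pow_iff (by norm_num) (by norm_num)).mp hc') hv
        (by rintro rfl; simp at hm) (by rw [e2]; ring)
      exact ih _ (hN ▸ a4) f g v rfl a1 a2 (by rintro rfl; simp at hv) a3
    have hr2 : r % 2 = 1 := by
      rcases Int.emod_two_eq_zero_or_one r with h | h
      · exfalso
        have := Int.isCoprime_iff_gcd_eq_one.mp hqr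
        have h3 := Int.dvd_coe_gcd (Int.dvd_of_emod_eq_zero hq2) (Int.dvd_of_emod_eq_zero h)
        rw [this] at h3
        norm_num at h3
      · exact h
    have tr : PythagoreanTriple r (q ^ 2) (p ^ 2) := by
      unfold PythagoreanTriple; linarith
    obtain ⟨m, n, h1, h2, h3, h4, h5, h6⟩ := tr.coprime_classification'
      (Int.isCoprime_iff_gcd_eq_one.mp hqr.symm.pow_right) hr2 (by positivity)
    have hq0 : 0 < q ^ 2 := by positivity
    have hm : 0 < m := by
      rcases h6.lt_or_eq with h | h
      · exact h
      · rw [← h] at h2; linarith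
    have hn : 0 < n := by
      by_contra hl
      nlinarith
    have hc := Int.isCoprime_iff_gcd_eq_one.mpr h4
    rcases h5 with ⟨h5, h7⟩ | ⟨h5, h7⟩
    · exact key m n hm hn hc h5 h7 h2 h3
    · exact key n m hn hm hc.symm h7 h5 (by linarith) (by linarith)
  · have tr : PythagoreanTriple (q ^ 2) r (p ^ 2) := by
      unfold PythagoreanTriple; linarith
    obtain ⟨m, n, h1, h2, h3, h4, h5, h6⟩ := tr.coprime_classification'
      (Int.isCoprime_iff_gcd_eq_one.mp hqr.pow_left)
      (by rw [pow_two, Int.mul_emod, hq2]; rfl) (by positivity)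
    have hn : n ≠ 0 := by rintro rfl; simp at h2; exact hr h2
    have hn2 : 0 < n ^ 2 := by positivity
    refine ih _ ?_ m n (p * q) rfl (Int.isCoprime_iff_gcd_eq_one.mpr h4) hn (by positivity) ?_
    · rw [← hN]; rw [Int.natAbs_lt_iff_sq_lt]; linarith
    · rw [mul_pow, h3, h1]; ring

theorem fq_L2 {p q r : ℤ} (hpq : IsCoprime p q) (hp : p % 2 = 1) (hq : q ≠ 0)
    (e : p ^ 4 = 4 * q ^ 4 + r ^ 2) : False := by
  have hr : r % 2 = 1 := by
    have h1 : p ^ 4 % 2 = 1 := by rw [fq_pow_mod, hp]; rfl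
    rcases Int.emod_two_eq_zero_or_one r with h | h
    · exfalso
      have : r ^ 2 % 2 = 0 := by rw [fq_pow_mod, h]; rfl
      omega
    · exact h
  have hqr : IsCoprime q r := by
    have : IsCoprime q (r ^ 2) := by
      have h : IsCoprime q (p ^ 4) := hpq.symm.pow_right
      rw [e] at h
      have := h.add_mul_left_right (-4 * q^3)
      exact (fq_congr (by ring) (by ring)).mp this
    exact (IsCoprime.pow_right_iff (by norm_num)).mp this
  have tr : PythagoreanTriple r (2 * q ^ 2) (p ^ 2) := by
    unfold PythagoreanTriple; linarith
  have hp0 : p ≠ 0 := by rintro rfl; simp at hp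
  have hco : IsCoprime r (2 * q ^ 2) := 
    IsCoprime.mul_right ⟨1, -(r/2), by omega⟩ hqr.symm.pow_right
  obtain ⟨m, n, h1, h2, h3, h4, h5, h6⟩ := tr.coprime_classification'
      (Int.isCoprime_iff_gcd_eq_one.mp hco) hr (by positivity)
  have hq0 : 0 < q ^ 2 := by positivity
  have hm : 0 < m := by
    rcases h6.lt_or_eq with h | h
    · exact h
    · rw [← h] at h2; linarith
  have hn : 0 < n := by
    by_contra hl
    nlinarith
  have hc := Int.isCoprime_iff_gcd_eq_one.mpr h4
  obtain ⟨u, rfl⟩ := fq_sqpos hm hc (by linarith : m * n = q ^ 2)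
  obtain ⟨v, rfl⟩ := fq_sqpos hn hc.symm (by linarith : n * u ^ 2 = q ^ 2)
  exact not_fermat_42 (a := u) (b := v) (c := p) (by rintro rfl; simp at hm)
    (by rintro rfl; simp at hn) (by rw [h3]; ring)

theorem fq_three {a b e c : ℤ} (ha : 0 < a) (hb : 0 < b) (he : 0 < e) (hab : IsCoprime a b)
    (hae : IsCoprime a e) (hbe : IsCoprime b e) (h : a * b * e = c ^ 2) :
    ∃ p q r : ℤ, a = p ^ 2 ∧ b = q ^ 2 ∧ e = r ^ 2 := by
  obtain ⟨p, hp⟩ := fq_sqpos (c := c) ha (hab.mul_right hae) (by linarith)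
  obtain ⟨q, hq⟩ := fq_sqpos (c := c) hb (hab.symm.mul_right hbe) (by linarith)
  obtain ⟨r, hr⟩ := fq_sqpos (c := c) he (hae.symm.mul_right hbe.symm) (by linarith)
  exact ⟨p, q, r, hp, hq, hr⟩

theorem fq_int1 {a b c : ℤ} (ha : 0 < a) (hb : 0 < b) (hab : IsCoprime a b) (hc : c ≠ 0)
    (e : a * b * (a ^ 2 - b ^ 2) = c ^ 2) : False := by
  have h0 : 0 < a ^ 2 - b ^ 2 := by
    have : 0 < c ^ 2 := by positivity
    exact pos_of_mul_pos_right (e ▸ this) (by positivity)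
  have h1 : IsCoprime a (a ^ 2 - b ^ 2) := by
    have := (hab.pow_right (n := 2)).neg_right.add_mul_left_right a
    exact (fq_congr (by ring) (by ring)).mp this
  have h2 : IsCoprime b (a ^ 2 - b ^ 2) := by
    have := (hab.symm.pow_right (n := 2)).add_mul_left_right (-b)
    exact (fq_congr (by ring) (by ring)).mp this
  obtain ⟨p, q, r, rfl, rfl, hr⟩ := fq_three ha hb h0 hab h1 h2 e
  refine fq_L1 _ p q r rfl ((IsCoprime.pow_iff (by norm_num) (by norm_num)).mp hab)
    (by rintro rfl; simp at hb) (by rintro rfl; simp at hr; omega) (by linarith)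

theorem fq_int2 {a b c : ℤ} (ha : 0 < a) (hb : 0 < b) (hab : IsCoprime a b) (hc : c ≠ 0)
    (e : a * b * (a ^ 2 - b ^ 2) = 2 * c ^ 2) : False := by
  have h0 : 0 < a ^ 2 - b ^ 2 := by
    have : 0 < 2 * c ^ 2 := by positivity
    exact pos_of_mul_pos_right (e ▸ this) (by positivity)
  have h1 : IsCoprime a (a ^ 2 - b ^ 2) := by
    have := (hab.pow_right (n := 2)).neg_right.add_mul_left_right a
    exact (fq_congr (by ring) (by ring)).mp this
  have h2 : IsCoprime b (a ^ 2 - b ^ 2) := by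
    have := (hab.symm.pow_right (n := 2)).add_mul_left_right (-b)
    exact (fq_congr (by ring) (by ring)).mp this
  have hpar : ¬ (a % 2 = 0 ∧ b % 2 = 0) := by
    rintro ⟨h, h'⟩
    have := Int.isCoprime_iff_gcd_eq_one.mp hab
    have h3 := Int.dvd_coe_gcd (Int.dvd_of_emod_eq_zero h) (Int.dvd_of_emod_eq_zero h')
    rw [this] at h3
    norm_num at h3
  have odd_sq : ∀ z : ℤ, z % 2 = 1 → z ^ 2 % 8 = 1 := by
    intro z hz
    have h8 : z % 8 = 1 ∨ z % 8 = 3 ∨ z % 8 = 5 ∨ z % 8 = 7 := by omega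
    rw [fq_pow_mod]
    rcases h8 with h | h | h | h <;> rw [h] <;> rfl
  have sq_odd : ∀ z : ℤ, z ^ 2 % 2 = 1 → z % 2 = 1 := by
    intro z hz
    rcases Int.emod_two_eq_zero_or_one z with h | h
    · rw [fq_pow_mod, h] at hz; simp at hz
    · exact h
  rcases Int.emod_two_eq_zero_or_one a with ha2 | ha2
  · have hb2 : b % 2 = 1 := by omega
    obtain ⟨a', rfl⟩ : (2:ℤ) ∣ a := Int.dvd_of_emod_eq_zero ha2
    obtain ⟨p, q, r, rfl, rfl, hr⟩ := fq_three (c := c) (by linarith : 0 < a') hb h0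
      hab.of_mul_left_right h1.of_mul_left_right h2 (by linarith)
    have h3 := odd_sq _ hb2
    have h4 : r ^ 2 % 4 ≠ 3 := by
      rcases Int.emod_two_eq_zero_or_one r with h | h
      · obtain ⟨s, rfl⟩ : (2:ℤ) ∣ r := Int.dvd_of_emod_eq_zero h
        rw [mul_pow]; omega
      · have := odd_sq _ h; omega
    rw [← hr, mul_pow] at h4
    omega
  rcases Int.emod_two_eq_zero_or_one b with hb2 | hb2
  · obtain ⟨b', rfl⟩ : (2:ℤ) ∣ b := Int.dvd_of_emod_eq_zero hb2
    obtain ⟨p, q, r, rfl, rfl, hr⟩ := fq_three (c := c) ha (by linarith : 0 < b') h0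
      hab.of_mul_right_right h1 h2.of_mul_left_right (by linarith)
    exact fq_L2 (p := p) (q := q) (r := r)
      ((IsCoprime.pow_iff (by norm_num) (by norm_num)).mp hab.of_mul_right_right)
      (sq_odd _ ha2) (by rintro rfl; simp at hb) (by linarith)
  · obtain ⟨e', he'⟩ : (2:ℤ) ∣ a ^ 2 - b ^ 2 := by
      have := odd_sq _ ha2; have := odd_sq _ hb2; omega
    rw [he'] at h0 h1 h2 e
    obtain ⟨p, q, r, rfl, rfl, rfl⟩ := fq_three (c := c) ha hb (by linarith : 0 < e') hab
      h1.of_mul_right_right h2.of_mul_right_right (by linarith)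
    obtain ⟨w, hw⟩ : (2:ℤ) ∣ p ^ 2 + q ^ 2 := by omega
    have hpq2 : (p ^ 2) % 8 = 1 := odd_sq _ (sq_odd _ ha2)
    have hqq2 : (q ^ 2) % 8 = 1 := odd_sq _ (sq_odd _ hb2)
    have hw1 : w % 2 = 1 := by omega
    have hr0 : 0 < r ^ 2 := by linarith
    have hw0 : 0 < w := by nlinarith
    have hprod : w * (p ^ 2 - q ^ 2) = r ^ 2 := by
      have : 2 * w * (p ^ 2 - q ^ 2) = 2 * r ^ 2 := by rw [← hw, ← he']; ring
      linarith
    have hd0 : 0 < p ^ 2 - q ^ 2 := pos_of_mul_pos_right (hprod ▸ hr0) hw0.le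
    have hcop : IsCoprime w (p ^ 2 - q ^ 2) := by
      have hx : IsCoprime w (2 * p ^ 2) := by
        refine IsCoprime.mul_right ⟨1, -(w/2), by omega⟩ ?_
        have : IsCoprime (2 * w) (p ^ 2) := by
          rw [← hw]
          have := hab.symm.add_mul_left_left 1
          exact (fq_congr (by ring) (by ring)).mp this
        exact this.of_mul_left_right
      have := hx.add_mul_left_right (-2)
      exact (fq_congr rfl (by linarith)).mp this
    obtain ⟨s, rfl⟩ := fq_sqpos hw0 hcop hprod
    obtain ⟨t, ht⟩ := fq_sqpos hd0 hcop.symm (by linarith : (p ^ 2 - q ^ 2) * s ^ 2 = r ^ 2)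
    have ht2 : t % 2 = 0 := by
      rcases Int.emod_two_eq_zero_or_one t with h | h
      · exact h
      · have := odd_sq _ h; omega
    obtain ⟨t', rfl⟩ : (2:ℤ) ∣ t := Int.dvd_of_emod_eq_zero ht2
    refine fq_L2 (p := s) (q := t') (r := p * q) ?_ (sq_odd _ hw1) ?_ ?_
    · rw [ht] at hcop
      exact ((IsCoprime.pow_iff (by norm_num) (by norm_num)).mp hcop).of_mul_right_right
    · rintro rfl; simp at ht; linarith
    · have e1 : p ^ 2 = s ^ 2 + 2 * t' ^ 2 := by linarith
      have e2 : q ^ 2 = s ^ 2 - 2 * t' ^ 2 := by linarith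
      rw [mul_pow, e1, e2]; ring

theorem fq_rat_pos {x y d : ℚ} (hd : d = 1 ∨ d = 2) (hy : y ≠ 0) (hx : 0 < x)
    (e : d * y ^ 2 = x ^ 3 - x) : False := by
  have hden : (x.den : ℚ) ≠ 0 := by exact_mod_cast x.den_ne_zero
  have hx' : x = x.num / x.den := (Rat.num_div_den x).symm
  set a := x.num with ha
  obtain ⟨b, hb⟩ : ∃ b : ℤ, b = x.den := ⟨_, rfl⟩
  have hb0 : (b:ℚ) ≠ 0 := by rw [hb]; exact_mod_cast hden
  have hxb : x * b = a := by
    rw [hx']; rw [hb]; push_cast; field_simp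
  have hE : d * (b ^ 2 * y) ^ 2 = a * b * (a ^ 2 - b ^ 2) := by
    rw [← hxb]; linear_combination (b:ℚ)^4 * e
  have hap : 0 < a := Rat.num_pos.mpr hx
  have hbp : 0 < b := by rw [hb]; exact_mod_cast x.den_pos
  have hab : IsCoprime a b := by
    rw [Int.isCoprime_iff_gcd_eq_one, hb]; exact x.reduced
  have hz : ∃ c : ℤ, (c:ℚ) = d * (b ^ 2 * y) := by
    have : IsIntegral ℤ (d * (b ^ 2 * y)) := by
      refine IsIntegral.of_pow (n := 2) (by norm_num) ?_
      rcases hd with rfl | rfl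
      · have : (1 * ((b:ℚ) ^ 2 * y)) ^ 2 = ((a * b * (a ^ 2 - b ^ 2) : ℤ) : ℚ) := by
          push_cast; rw [← hE]; ring
        rw [this]; exact isIntegral_algebraMap
      · have : (2 * ((b:ℚ) ^ 2 * y)) ^ 2 = ((2 * (a * b * (a ^ 2 - b ^ 2)) : ℤ) : ℚ) := by
          push_cast; rw [← hE]; ring
        rw [this]; exact isIntegral_algebraMap
    obtain ⟨c, hc⟩ := IsIntegrallyClosed.isIntegral_iff.mp this
    exact ⟨c, hc⟩
  obtain ⟨c, hc⟩ := hz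
  have hc0 : c ≠ 0 := by
    rintro rfl
    have : d ≠ 0 := by rcases hd with rfl | rfl <;> norm_num
    have : d * (b ^ 2 * y) ≠ 0 := by positivity
    exact this (by rw [← hc]; simp)
  rcases hd with rfl | rfl
  · refine fq_int1 hap hbp hab hc0 ?_
    have : ((a * b * (a ^ 2 - b ^ 2) : ℤ) : ℚ) = ((c ^ 2 : ℤ) : ℚ) := by
      push_cast; rw [← hE, hc]; ring
    exact_mod_cast this
  · have h2 : 2 * (a * b * (a ^ 2 - b ^ 2)) = c ^ 2 := by
      have : ((2 * (a * b * (a ^ 2 - b ^ 2)) : ℤ) : ℚ) = ((c ^ 2 : ℤ) : ℚ) := by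
        push_cast; rw [← hE, hc]; ring
      exact_mod_cast this
    obtain ⟨c', rfl⟩ : (2:ℤ) ∣ c := Int.prime_two.dvd_of_dvd_pow ⟨_, h2.symm⟩
    exact fq_int2 (c := c') hap hbp hab (by rintro rfl; simp at hc0) (by linarith)

theorem fq_rat' {x y d : ℚ} (hd : d = 1 ∨ d = 2) 
    (e : d * y ^ 2 = x ^ 3 - x) : y = 0 := by
  by_contra hy
  rcases lt_trichotomy x 0 with h | h | h
  · have hx : x ≠ 0 := h.ne
    refine fq_rat_pos (x := -1/x) (y := y / x ^ 2) hd (by positivity) ?_ ?_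
    · exact div_pos_of_neg_of_neg (by norm_num) h
    · field_simp
      linear_combination e
  · subst h
    have : 0 < y ^ 2 := by positivity
    rcases hd with rfl | rfl <;> linarith
  · exact fq_rat_pos hd hy h e

theorem fq_rat {x y d : ℚ} (hd : d = 1 ∨ d = 2 ∨ d = -1 ∨ d = -2) 
    (e : d * y ^ 2 = x ^ 3 - x) : y = 0 := by
  rcases hd with h | h | rfl | rfl
  · exact fq_rat' (Or.inl h) e
  · exact fq_rat' (Or.inr h) e
  · exact fq_rat' (x := -x) (Or.inl rfl) (by linear_combination -e)
  · exact fq_rat' (x := -x) (Or.inr rfl) (by linear_combination -e)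
/-- Package of the facts about `ℚ(i, √2)` that the proof uses. -/
structure FQData (K : Type) [Field K] [Algebra ℚ K] where
  i : K
  s : K
  σ : K →ₐ[ℚ] K
  τ : K →ₐ[ℚ] K
  hi : i ^ 2 = -1
  hs : s ^ 2 = 2
  σi : σ i = i
  σs : σ s = -s
  τi : τ i = -i
  τs : τ s = -s
  σσ : ∀ x, σ (σ x) = x
  ττ : ∀ x, τ (τ x) = x
  στ : ∀ x, σ (τ x) = τ (σ x)
  fixed : ∀ x, σ x = x → τ x = x → ∃ q : ℚ, x = algebraMap ℚ K q

theorem fq_data : Nonempty (FQData (CyclotomicField 8 ℚ)) := by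
  have : NeZero ((8 : ℕ) : ℚ) := ⟨by norm_num⟩
  have : IsCyclotomicExtension {8} ℚ (CyclotomicField 8 ℚ) :=
    CyclotomicField.isCyclotomicExtension 8 ℚ
  have hirr : Irreducible (Polynomial.cyclotomic 8 ℚ) :=
    Polynomial.cyclotomic.irreducible_rat (by norm_num)
  have hz := IsCyclotomicExtension.zeta_spec 8 ℚ (CyclotomicField 8 ℚ)
  obtain ⟨z, hzz⟩ : ∃ z, z = IsCyclotomicExtension.zeta 8 ℚ (CyclotomicField 8 ℚ) := ⟨_, rfl⟩
  rw [← hzz] at hz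
  have hz4 : z ^ 4 = -1 := by
    have h8 : (z ^ 4 - 1) * (z ^ 4 + 1) = 0 := by
      linear_combination hz.pow_eq_one
    rcases mul_eq_zero.mp h8 with h | h
    · exact absurd (sub_eq_zero.mp h) (hz.pow_ne_one_of_pos_of_lt (by norm_num) (by norm_num))
    · linear_combination h
  have aut : ∀ k : ℕ, Nat.Coprime k 8 → ∃ f : CyclotomicField 8 ℚ ≃ₐ[ℚ] CyclotomicField 8 ℚ,
      f z = z ^ k := by
    intro k hk
    refine ⟨IsCyclotomicExtension.fromZetaAut (hz.pow_of_coprime k hk) hirr, ?_⟩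
    have := IsCyclotomicExtension.fromZetaAut_spec (hz.pow_of_coprime k hk) hirr
    rwa [← hzz] at this
  have ext : ∀ f g : CyclotomicField 8 ℚ →ₐ[ℚ] CyclotomicField 8 ℚ, f z = g z → f = g := by
    intro f g h
    refine (hz.powerBasis ℚ).algHom_ext ?_
    simpa using h
  obtain ⟨σ, hσ⟩ := aut 5 (by norm_num)
  obtain ⟨τ, hτ⟩ := aut 3 (by norm_num)
  have hz8 : z ^ 8 = 1 := hz.pow_eq_one
  have σσ : ∀ x, σ (σ x) = x := by
    intro x
    have := ext (σ.toAlgHom.comp σ.toAlgHom) (AlgHom.id ℚ _) (by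
      simp [hσ]; linear_combination (z ^ 17 + z ^ 9 + z) * hz8)
    exact DFunLike.congr_fun this x
  have ττ : ∀ x, τ (τ x) = x := by
    intro x
    have := ext (τ.toAlgHom.comp τ.toAlgHom) (AlgHom.id ℚ _) (by
      simp [hτ]; linear_combination (z) * hz8)
    exact DFunLike.congr_fun this x
  have στ : ∀ x, σ (τ x) = τ (σ x) := by
    intro x
    have := ext (σ.toAlgHom.comp τ.toAlgHom) 
      (τ.toAlgHom.comp σ.toAlgHom) (by
      simp [hτ, hσ]; ring)
    exact DFunLike.congr_fun this x
  have : IsGalois ℚ (CyclotomicField 8 ℚ) := IsCyclotomicExtension.isGalois {8} ℚ _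
  refine ⟨⟨z ^ 2, z - z ^ 3, σ, τ, ?_, ?_, ?_, ?_, ?_, ?_, σσ, ττ, στ, ?_⟩⟩
  · linear_combination hz4
  · linear_combination (-2 + z ^ 2) * hz4
  · simp [hσ]; linear_combination z ^ 2 * hz8
  · simp [hσ]; linear_combination (z - z ^ 11 + z ^ 7 - z ^ 3) * hz4
  · simp [hτ]; linear_combination z ^ 2 * hz4
  · simp [hτ]; linear_combination (-z ^ 5 + z) * hz4 + 2 * z * hz8
  · intro x h1 h2
    obtain ⟨q, hq⟩ := (IsGalois.mem_range_algebraMap_iff_fixed (F := ℚ) x).mpr (by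
      intro f
      have hf : f z ^ 8 = 1 := by rw [← map_pow, hz8, map_one]
      obtain ⟨k, hk8, hk⟩ := hz.eq_pow_of_pow_eq_one hf
      have hf4 : f z ^ 4 = -1 := by rw [← map_pow, hz4, map_neg, map_one]
      have hodd : k % 2 = 1 := by
        by_contra hc
        obtain ⟨j, rfl⟩ : 2 ∣ k := by omega
        rw [← hk] at hf4
        have : (z ^ (2 * j)) ^ 4 = 1 := by
          rw [← pow_mul, show 2 * j * 4 = 8 * j by ring, pow_mul, hz8, one_pow]
        rw [this] at hf4
        norm_num at hf4
      have hcases : k = 1 ∨ k = 3 ∨ k = 5 ∨ k = 7 := by omega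
      rcases hcases with rfl | rfl | rfl | rfl
      · have := ext f.toAlgHom (AlgHom.id ℚ _) (by simp [← hk])
        exact DFunLike.congr_fun this x
      · have := ext f.toAlgHom τ.toAlgHom (by simp [← hk, hτ])
        exact (DFunLike.congr_fun this x).trans h2
      · have := ext f.toAlgHom σ.toAlgHom (by simp [← hk, hσ])
        exact (DFunLike.congr_fun this x).trans h1
      · have := ext f.toAlgHom (σ.toAlgHom.comp τ.toAlgHom) (by
          simp [← hk, hσ, hτ]; linear_combination -z ^ 7 * hz8)
        refine (DFunLike.congr_fun this x).trans ?_
        change σ (τ x) = x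
        exact (congrArg σ h2).trans h1)
    exact ⟨q, hq.symm⟩

theorem fq_nonsq {K : Type} [Field K] [CharZero K] (f : K →+* K) (hf : ∀ x, f (f x) = x)
    {a c z : K} (hz : z ^ 2 = a) (hc : c ^ 2 = a * f a) (hfc : f c = -c) (h0 : c ≠ 0) : False := by
  have h1 : (z * f z) ^ 2 = c ^ 2 := by rw [hc, ← hz, map_pow]; ring
  have h2 : f (z * f z) = z * f z := by rw [map_mul, hf, mul_comm]
  rcases sq_eq_sq_iff_eq_or_eq_neg.mp h1 with h | h
  · rw [h, hfc] at h2
    exact h0 (self_eq_neg.mp h2.symm)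
  · rw [h, map_neg, hfc] at h2
    exact h0 (self_eq_neg.mp (by linear_combination h2))

open WeierstrassCurve in
/-- The curve `y² = x³ - x`. -/
def fqW : WeierstrassCurve ℚ := ⟨0, 0, 0, -1, 0⟩

namespace FQ
open WeierstrassCurve WeierstrassCurve.Affine

variable {K : Type} [Field K] [Algebra ℚ K]

theorem eqn_iff (x y : K) : (fqW⁄K).toAffine.Equation x y ↔ y ^ 2 = x ^ 3 - x := by
  rw [Affine.equation_iff]
  simp [fqW, sub_eq_add_neg]

theorem negY (x y : K) : (fqW⁄K).toAffine.negY x y = -y := by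
  simp [fqW, Affine.negY]

theorem nons [CharZero K] {x y : K} (h : y ^ 2 = x ^ 3 - x) : (fqW⁄K).toAffine.Nonsingular x y := by
  rw [Affine.nonsingular_iff, eqn_iff]
  refine ⟨h, ?_⟩
  simp [fqW]
  by_contra! hh
  obtain ⟨h1, h2⟩ := hh
  have hy : y = 0 := self_eq_neg.mp h2
  subst hy
  have h3 : 3 * (x * (x ^ 2 - 1)) = 0 := by linear_combination -3 * h
  have h4 : x * (3 * x ^ 2 - 1) = 0 := by linear_combination -x * h1
  have h5 : x = 0 := by linear_combination (1/2) * h4 - (1/2) * h3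
  subst h5
  simp at h1

variable [DecidableEq K]

theorem dbl_zero [CharZero K] {x y : K} {h : (fqW⁄K).toAffine.Nonsingular x y}
    (e : Point.some x y h + Point.some x y h = 0) : y = 0 := by
  by_contra hy
  rw [Point.add_self_of_Y_ne] at e
  · exact Point.some_ne_zero _ e
  · rw [negY]
    intro h
    exact hy (self_eq_neg.mp h)

theorem dbl_of_zero {x y : K} {h : (fqW⁄K).toAffine.Nonsingular x y} (hy : y = 0) :
    Point.some x y h + Point.some x y h = 0 :=
  Point.add_self_of_Y_eq (by rw [negY, hy, neg_zero])

theorem dbl_some [CharZero K] {x y x' y' : K} {h : (fqW⁄K).toAffine.Nonsingular x y}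
    {h' : (fqW⁄K).toAffine.Nonsingular x' y'}
    (e : Point.some x y h + Point.some x y h = Point.some x' y' h') :
    y ≠ 0 ∧ y ^ 2 = x ^ 3 - x ∧ 4 * y ^ 2 * x' = (x ^ 2 + 1) ^ 2 := by
  have hy : y ≠ 0 := by
    intro hy
    rw [dbl_of_zero hy] at e
    exact Point.some_ne_zero _ e.symm
  have hE := (eqn_iff x y).mp h.1
  have hn : y ≠ (fqW⁄K).toAffine.negY x y := by
    rw [negY]
    intro h
    exact hy (self_eq_neg.mp h)
  refine ⟨hy, hE, ?_⟩
  rw [Point.add_self_of_Y_ne hn] at e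
  have hx := (Point.some.inj e).1
  rw [Affine.slope_of_Y_ne rfl hn, negY] at hx
  simp [Affine.addX, fqW] at hx
  have h2 : y + y ≠ 0 := by rw [← two_mul]; exact mul_ne_zero two_ne_zero hy
  rw [← hx]
  field_simp
  ring_nf
  linear_combination (-32 * x) * hE

theorem eig [CharZero K] (D : FQData K) (Q : (fqW⁄K).toAffine.Point)
    (h1 : Point.map D.σ Q = Q ∨ Point.map D.σ Q = -Q)
    (h2 : Point.map D.τ Q = Q ∨ Point.map D.τ Q = -Q) : Q + Q = 0 := by
  rcases Q with _ | ⟨x, y, h⟩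
  · exact add_zero _
  apply dbl_of_zero
  have hE := (eqn_iff x y).mp h.1
  rw [Point.map_some, Point.neg_some, Point.some.injEq, Point.some.injEq, negY] at h1 h2
  have hi0 : D.i ≠ 0 := by intro h; have := D.hi; rw [h] at this; norm_num at this
  have hs0 : D.s ≠ 0 := by intro h; have := D.hs; rw [h] at this; norm_num at this
  have hx1 : D.σ x = x := by rcases h1 with h | h <;> exact h.1
  have hx2 : D.τ x = x := by rcases h2 with h | h <;> exact h.1
  obtain ⟨q, hq⟩ := D.fixed x hx1 hx2
  have fin : ∀ (c : K) (d : ℚ), c ≠ 0 → c ^ 2 = algebraMap ℚ K d → 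
      (d = 1 ∨ d = 2 ∨ d = -1 ∨ d = -2) → D.σ (y / c) = y / c → D.τ (y / c) = y / c → y = 0 := by
    intro c d hc hcd hd ha hb
    obtain ⟨r, hr⟩ := D.fixed _ ha hb
    have hy : y = c * algebraMap ℚ K r := by rw [← hr]; field_simp
    have : algebraMap ℚ K (d * r ^ 2) = algebraMap ℚ K (q ^ 3 - q) := by
      simp only [map_mul, map_pow, map_sub]
      rw [← hq, ← hcd, ← hE, hy]; ring
    have := fq_rat hd ((algebraMap ℚ K).injective this)
    rw [hy, this]; simp
  rcases h1 with ⟨-, h1⟩ | ⟨-, h1⟩ <;> rcases h2 with ⟨-, h2⟩ | ⟨-, h2⟩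
  · exact fin 1 1 one_ne_zero (by simp) (by simp) (by simp [h1]) (by simp [h2])
  · exact fin D.i (-1) hi0 (by simp [D.hi]) (by simp) (by simp [h1, D.σi]) (by simp [h2, D.τi])
  · exact fin (D.i * D.s) (-2) (mul_ne_zero hi0 hs0) (by simp [mul_pow, D.hi, D.hs]) (by simp)
      (by simp [h1, D.σi, D.σs]) (by simp [h2, D.τi, D.τs])
  · exact fin D.s 2 hs0 (by simp [D.hs]) (by simp) (by simp [h1, D.σs]) (by simp [h2, D.τs])

theorem map_invol (f : K →ₐ[ℚ] K) (hf : ∀ x, f (f x) = x) (P : (fqW⁄K).toAffine.Point) :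
    Point.map f (Point.map f P) = P := by
  rcases P with _ | ⟨x, y, h⟩
  · rfl
  · simp only [Point.map_some, hf]

theorem map_comm (f g : K →ₐ[ℚ] K) (hf : ∀ x, f (g x) = g (f x)) (P : (fqW⁄K).toAffine.Point) :
    Point.map f (Point.map g P) = Point.map g (Point.map f P) := by
  rcases P with _ | ⟨x, y, h⟩
  · rfl
  · simp only [Point.map_some, hf]

theorem eight [CharZero K] (D : FQData K) (P : (fqW⁄K).toAffine.Point) :
    ((P + P) + (P + P)) + ((P + P) + (P + P)) = 0 := by
  have hs := map_invol D.σ D.σσ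
  have ht := map_invol D.τ D.ττ
  have hst := map_comm D.σ D.τ D.στ
  set S := Point.map (W' := fqW) D.σ with hS
  set T := Point.map (W' := fqW) D.τ with hT
  have e1 := eig D ((P + S P) + T (P + S P)) (Or.inl (by
    rw [← hS]; simp only [map_add, hs, hst]; abel)) (Or.inl (by
    rw [← hT]; simp only [map_add, ht]; abel))
  have e2 := eig D ((P + S P) - T (P + S P)) (Or.inl (by
    rw [← hS]; simp only [map_add, map_sub, hs, hst]; abel)) (Or.inr (by
    rw [← hT]; simp only [map_add, map_sub, ht]; abel))
  have e3 := eig D ((P - S P) + T (P - S P)) (Or.inr (by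
    rw [← hS]; simp only [map_add, map_sub, hs, hst]; abel)) (Or.inl (by
    rw [← hT]; simp only [map_add, map_sub, ht]; abel))
  have e4 := eig D ((P - S P) - T (P - S P)) (Or.inr (by
    rw [← hS]; simp only [map_sub, hs, hst]; abel)) (Or.inr (by
    rw [← hT]; simp only [map_sub, ht]; abel))
  calc _ = (((P + S P) + T (P + S P)) + ((P + S P) + T (P + S P)))
      + (((P + S P) - T (P + S P)) + ((P + S P) - T (P + S P)))
      + (((P - S P) + T (P - S P)) + ((P - S P) + T (P - S P)))
      + (((P - S P) - T (P - S P)) + ((P - S P) - T (P - S P))) := by abel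
    _ = 0 := by rw [e1, e2, e3, e4]; simp

theorem half [CharZero K] (D : FQData K) {x y x' y' : K} {h : (fqW⁄K).toAffine.Nonsingular x y}
    {h' : (fqW⁄K).toAffine.Nonsingular x' y'}
    (e : Point.some x y h + Point.some x y h = Point.some x' y' h') (hy' : y' = 0) :
    (x = D.i ∨ x = -D.i) ∨ (x = 1 + D.s ∨ x = 1 - D.s) ∨ (x = -1 + D.s ∨ x = -1 - D.s) := by
  obtain ⟨hy, hE, h4⟩ := dbl_some e
  have hE' := (eqn_iff x' y').mp h'.1
  have hx' : x' * ((x' - 1) * (x' + 1)) = 0 := by rw [hy'] at hE'; linear_combination -hE'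
  rcases mul_eq_zero.mp hx' with h0 | h0
  · left
    have : x ^ 2 + 1 = 0 := by
      have : (x ^ 2 + 1) ^ 2 = 0 := by rw [← h4, h0]; ring
      exact pow_eq_zero_iff (two_ne_zero) |>.mp this
    apply sq_eq_sq_iff_eq_or_eq_neg.mp
    rw [D.hi]; linear_combination this
  right
  rcases mul_eq_zero.mp h0 with h0 | h0
  · left
    have : x ^ 2 - 2 * x - 1 = 0 := by
      have : (x ^ 2 - 2 * x - 1) ^ 2 = 0 := by
        linear_combination -h4 + 4 * y ^ 2 * h0 + 4 * hE
      exact pow_eq_zero_iff (two_ne_zero) |>.mp this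
    have h2 : (x - 1) ^ 2 = D.s ^ 2 := by rw [D.hs]; linear_combination this
    rcases sq_eq_sq_iff_eq_or_eq_neg.mp h2 with h | h
    · left; linear_combination h
    · right; linear_combination h
  · right
    have : x ^ 2 + 2 * x - 1 = 0 := by
      have : (x ^ 2 + 2 * x - 1) ^ 2 = 0 := by
        linear_combination -h4 + 4 * y ^ 2 * h0 - 4 * hE
      exact pow_eq_zero_iff (two_ne_zero) |>.mp this
    have h2 : (x + 1) ^ 2 = D.s ^ 2 := by rw [D.hs]; linear_combination this
    rcases sq_eq_sq_iff_eq_or_eq_neg.mp h2 with h | h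
    · left; linear_combination h
    · right; linear_combination h

theorem nsq_s [CharZero K] (D : FQData K) {x z : K} (hz : z ^ 2 = x) 
    (hx : (x = 1 + D.s ∨ x = 1 - D.s) ∨ (x = -1 + D.s ∨ x = -1 - D.s)) : False := by
  have hi0 : D.i ≠ 0 := by intro h; have := D.hi; rw [h] at this; norm_num at this
  refine fq_nonsq (D.τ : K →+* K) D.ττ (c := D.i) hz ?_ D.τi hi0
  rcases hx with (rfl | rfl) | (rfl | rfl) <;> simp [D.τs, D.hi] <;> linear_combination D.hs

theorem nsq_i [CharZero K] (D : FQData K) {x z : K} (hz : z ^ 2 = x + 1) 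
    (hx : x = D.i ∨ x = -D.i) : False := by
  have hs0 : D.s ≠ 0 := by intro h; have := D.hs; rw [h] at this; norm_num at this
  refine fq_nonsq (D.τ : K →+* K) D.ττ (c := D.s) hz ?_ D.τs hs0
  rcases hx with rfl | rfl <;> simp [D.τi, D.hs] <;> linear_combination D.hi

theorem nsq_r [CharZero K] (D : FQData K) {x z : K} (hz : z ^ 2 = x) 
    (hx : x = D.s ∨ x = -D.s) : False := by
  have hi0 : D.i ≠ 0 := by intro h; have := D.hi; rw [h] at this; norm_num at this
  have hs0 : D.s ≠ 0 := by intro h; have := D.hs; rw [h] at this; norm_num at this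
  refine fq_nonsq (D.σ : K →+* K) D.σσ (c := D.i * D.s) hz ?_ (by simp [D.σi, D.σs])
    (mul_ne_zero hi0 hs0)
  rcases hx with rfl | rfl <;> simp [D.σs, mul_pow, D.hi] <;> ring

theorem xcoord [CharZero K] (D : FQData K) {x y : K} (hE : y ^ 2 = x ^ 3 - x) (hy : y ≠ 0) :
    (x = D.i ∨ x = -D.i) ∨ (x = 1 + D.s ∨ x = 1 - D.s) ∨ (x = -1 + D.s ∨ x = -1 - D.s) := by
  have h8 := eight D (Point.some x y (nons hE))
  rcases hQ : Point.some x y (nons hE) + Point.some x y (nons hE) with _ | ⟨x1, y1, h1⟩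
  · exact absurd (dbl_zero hQ) hy
  rw [hQ] at h8
  refine half D hQ ?_
  rcases hR : Point.some x1 y1 h1 + Point.some x1 y1 h1 with _ | ⟨x2, y2, h2⟩
  · exact dbl_zero hR
  exfalso
  rw [hR] at h8
  have hl := half D hR (dbl_zero h8)
  obtain ⟨-, -, h4⟩ := dbl_some hQ
  rcases hl with hl | hl
  · refine nsq_i D (z := (x ^ 2 + 2 * x - 1) / (2 * y)) ?_ hl
    field_simp
    linear_combination -h4 - 4 * hE
  · refine nsq_s D (z := (x ^ 2 + 1) / (2 * y)) ?_ hl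
    field_simp
    linear_combination -h4

theorem trivial_points [CharZero K] (D : FQData K) {x y : K} (h : x ^ 4 + y ^ 4 = 1) :
    x = 0 ∨ y = 0 := by
  by_contra! hxy
  obtain ⟨hx, hy⟩ := hxy
  have hX := xcoord D (x := 1 / y ^ 2) (y := x ^ 2 / y ^ 3) (by
    field_simp; linear_combination h) (by positivity)
  rcases hX with hX | hX
  · have h1 : (1 / y ^ 2) ^ 2 = -1 := by rcases hX with h | h <;> rw [h] <;> simp [D.hi]
    have h2 : y ^ 4 = -1 := by
      field_simp at h1
      linear_combination h1
    have h3 : (x ^ 2) ^ 2 = D.s ^ 2 := by rw [D.hs]; linear_combination h - h2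
    exact nsq_r D (z := x) rfl (sq_eq_sq_iff_eq_or_eq_neg.mp h3)
  · exact nsq_s D (z := 1 / y) (by field_simp) hX

theorem main [CharZero K] (D : FQData K) :
    {p : K × K | p.1 ^ 4 + p.2 ^ 4 = 1}.ncard = 8 := by
  have hi := D.hi
  generalize hI : D.i = i at hi
  have n1 : i ≠ 0 := by rintro rfl; norm_num at hi
  have n2 : i ≠ 1 := by rintro rfl; norm_num at hi
  have n3 : i ≠ -1 := by rintro rfl; norm_num at hi
  have n4 : i ≠ -i := by intro h; exact n1 (self_eq_neg.mp h)
  have n5 : (1 : K) ≠ -1 := by norm_num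
  have n6 : -i ≠ 1 := by intro h; exact n3 (by linear_combination -h)
  have four : ∀ x : K, x ^ 4 = 1 → x = 1 ∨ x = -1 ∨ x = i ∨ x = -i := by
    intro x hx
    have : (x - 1) * ((x + 1) * ((x - i) * (x + i))) = 0 := by
      linear_combination hx + (-x ^ 2 + 1) * hi
    rcases mul_eq_zero.mp this with h | h
    · left; linear_combination h
    rcases mul_eq_zero.mp h with h | h
    · right; left; linear_combination h
    rcases mul_eq_zero.mp h with h | h
    · right; right; left; linear_combination h
    · right; right; right; linear_combination h
  have i4 : i ^ 4 = 1 := by linear_combination (i ^ 2 - 1) * hi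
  have hset : {p : K × K | p.1 ^ 4 + p.2 ^ 4 = 1} =
      (({(0, 1), (0, -1), (0, i), (0, -i), (1, 0), (-1, 0), (i, 0), (-i, 0)} :
        Finset (K × K)) : Set _) := by
    ext ⟨x, y⟩
    simp only [Set.mem_ofPred_eq, Finset.coe_insert, Finset.coe_singleton, Set.mem_insert_iff,
      Set.mem_singleton_iff, Prod.mk.injEq]
    constructor
    · intro h
      rcases trivial_points D h with rfl | rfl
      · have := four y (by linear_combination h)
        rcases this with rfl | rfl | rfl | rfl <;> simp
      · have := four x (by linear_combination h)
        rcases this with rfl | rfl | rfl | rfl <;> simp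
    · rintro (⟨rfl, rfl⟩ | ⟨rfl, rfl⟩ | ⟨rfl, rfl⟩ | ⟨rfl, rfl⟩ | ⟨rfl, rfl⟩ | ⟨rfl, rfl⟩ |
        ⟨rfl, rfl⟩ | ⟨rfl, rfl⟩) <;> simp [Even.neg_pow (show Even 4 by decide), i4]
  rw [hset, Set.ncard_coe_finset]
  have m1 : (1 : K) ≠ i := n2.symm
  have m2 : (-1 : K) ≠ i := n3.symm
  have m3 : (1 : K) ≠ -i := n6.symm
  repeat rw [Finset.card_insert_of_notMem]
  · simp
  all_goals simp [n1, n2, n3, n4, n5, n6, m1, m2, m3, n1.symm]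

end FQ

/-- The set of affine points of the Fermat quartic over the 8-th cyclotomic
field `ℚ(ζ₈)` has exactly 8 elements. -/
theorem fermat_quartic_affine_points_cyclotomic_eight :
    {p : CyclotomicField 8 ℚ × CyclotomicField 8 ℚ |
      p.1 ^ 4 + p.2 ^ 4 = 1}.ncard = 8 := by
  classical
  obtain ⟨D⟩ := fq_data
  exact FQ.main D
end

section
/- Let K be a field of characteristic zero containing a primitive 8-th root of unity with finrank ℚ K = 8 (so K is a quadratic extension of ℚ(ζ₈)). Assume K contains no fourth root of 2 (¬∃ x ∈ K, x⁴ = 2), no primitive cube root of unity (¬∃ x ∈ K, x² + x + 1 = 0), and no square root of −7 (¬∃ x ∈ K, x² = −7). Then for all x, y, z ∈ K with x⁴ + y⁴ = z⁴ one has x·y·z = 0. -/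
theorem Int.fq_nonneg_sq {a b c : ℤ} (h : Int.gcd a b = 1) (heq : a * b = c ^ 2) (ha : 0 < a) :
    ∃ r, a = r ^ 2 := by
  obtain ⟨r, hr | hr⟩ := Int.sq_of_gcd_eq_one h heq
  · exact ⟨r, hr⟩
  · nlinarith [sq_nonneg r]

theorem fq_step_even {e o a b : ℤ} (he0 : 0 < e) (ho0 : 0 < o) (ha : 0 < a)
    (hg : Int.gcd o e = 1) (ho : o % 2 = 1)
    (h1 : o * (2 * e) = b ^ 2) (h2 : o ^ 2 + e ^ 2 = a ^ 2) :
    ∃ k l r : ℤ, k ^ 4 = l ^ 4 + r ^ 2 ∧ l ≠ 0 ∧ r ≠ 0 ∧ k.natAbs < a.natAbs := by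
  have ho2 : Int.gcd o 2 = 1 := by
    rw [Int.gcd_comm]
    exact Int.isCoprime_iff_gcd_eq_one.1 ((Int.prime_two.coprime_iff_not_dvd).2 (by omega))
  have hg2 : Int.gcd o (2 * e) = 1 := by
    rw [← Int.isCoprime_iff_gcd_eq_one] at *
    exact IsCoprime.mul_right ho2 hg
  obtain ⟨r, hr⟩ := Int.fq_nonneg_sq hg2 h1 ho0
  obtain ⟨w, hw⟩ := Int.fq_nonneg_sq (by rwa [Int.gcd_comm]) (by rw [mul_comm]; exact h1) (by omega : 0 < 2 * e)
  have hw2 : (2:ℤ) ∣ w := Int.prime_two.dvd_of_dvd_pow (⟨e, hw.symm⟩ : (2:ℤ) ∣ w ^ 2)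
  obtain ⟨v, rfl⟩ := hw2
  have hev : e = 2 * v ^ 2 := by nlinarith
  have hp : PythagoreanTriple o e a := by unfold PythagoreanTriple; nlinarith
  obtain ⟨k, l, h3, h4, h5, h6, -, h8⟩ := hp.coprime_classification' hg ho ha
  have hkl : k * l = v ^ 2 := by nlinarith
  have hv : v ≠ 0 := by rintro rfl; simp at hev; omega
  have hklp : 0 < k * l := by rw [hkl]; positivity
  have hk : 0 < k := by
    rcases h8.lt_or_eq with h | h
    · exact h
    · rw [← h] at hklp; simp at hklp
  have hl : 0 < l := by
    by_contra hh
    nlinarith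
  obtain ⟨K, hK⟩ := Int.fq_nonneg_sq h6 hkl hk
  obtain ⟨J, hJ⟩ := Int.fq_nonneg_sq (by rwa [Int.gcd_comm]) (by rw [mul_comm]; exact hkl) hl
  refine ⟨K, J, r, ?_, ?_, ?_, ?_⟩
  · rw [hr, hK, hJ] at h3; linarith [h3, (by ring : (K^2)^2 = K^4), (by ring : (J^2)^2 = J^4)]
  · rintro rfl; simp at hJ; omega
  · rintro rfl; simp at hr; omega
  · rw [← Int.natAbs_abs K]
    have : |K| < a := by
      have h9 : |K| ^ 2 = k := by rw [sq_abs, hK]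
      have h10 : |K| ≤ k := by
        have := Int.le_self_sq |K|
        linarith
      have h11 : k ≤ k ^ 2 := Int.le_self_sq k
      have h12 : 0 < l ^ 2 := by positivity
      linarith
    have := abs_nonneg K
    omega

theorem fq_four_sub_aux (N : ℕ) : ∀ a b c : ℤ, a.natAbs = N → b ≠ 0 → c ≠ 0 → a ^ 4 = b ^ 4 + c ^ 2 → False := by
  induction N using Nat.strong_induction_on with
  | _ N ih =>
  intro a b c haN hb hc h
  wlog hap : 0 < a generalizing a with H
  · have ha0 : a ≠ 0 := by
      rintro rfl
      have : 0 < b ^ 4 := by positivity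
      nlinarith [sq_nonneg c]
    exact H (-a) (by rwa [Int.natAbs_neg]) (by rw [← h]; ring) (by omega)
  by_cases hg : Int.gcd a b = 1
  · by_cases hb2 : b % 2 = 1
    · have hp : PythagoreanTriple (b ^ 2) c (a ^ 2) := by unfold PythagoreanTriple; linarith
      have hcop : Int.gcd (b ^ 2) c = 1 := by
        rw [← Int.isCoprime_iff_gcd_eq_one] at *
        have h1 : IsCoprime (b ^ 4) (a ^ 4) := hg.symm.pow
        rw [h] at h1
        have h2 : IsCoprime (b ^ 4) (c ^ 2) := by
          have := h1.add_mul_left_right (-1)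
          simpa using this
        exact (IsCoprime.pow_iff (m := 2) (n := 2) (by norm_num) (by norm_num)).1 (by
          rw [← pow_mul]; exact h2)
      obtain ⟨m, n, h1, h2, h3, h4, -, h5⟩ := hp.coprime_classification' hcop
        (by rw [pow_two, Int.mul_emod, hb2]; rfl) (by positivity)
      have hn : n ≠ 0 := by rintro rfl; simp at h2; exact hc h2
      refine ih m.natAbs ?_ m n (a * b) rfl hn (by positivity) ?_
      · have : m < a := by
          have : 0 < n ^ 2 := by positivity
          nlinarith
        omega
      · have : (a * b) ^ 2 = (m ^ 2 + n ^ 2) * (m ^ 2 - n ^ 2) := by rw [mul_pow, h3, h1]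
        rw [this]; ring
    · have ha2 : a % 2 = 1 := by
        by_contra ha2
        have h1 : (2:ℤ) ∣ Int.gcd a b := Int.dvd_coe_gcd (by omega) (by omega)
        rw [hg] at h1; norm_num at h1
      have hc2 : c % 2 = 1 := by
        by_contra hc2
        have h1 : (2:ℤ) ∣ a ^ 4 := by
          rw [h]
          exact dvd_add (dvd_pow (by omega) (by norm_num)) (dvd_pow (by omega) (by norm_num))
        have := Int.prime_two.dvd_of_dvd_pow h1
        omega
      have hp : PythagoreanTriple c (b ^ 2) (a ^ 2) := by unfold PythagoreanTriple; linarith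
      have hcop : Int.gcd c (b ^ 2) = 1 := by
        rw [← Int.isCoprime_iff_gcd_eq_one] at *
        have h1 : IsCoprime (b ^ 4) (a ^ 4) := hg.symm.pow
        rw [h] at h1
        have h2 : IsCoprime (b ^ 4) (c ^ 2) := by
          have := h1.add_mul_left_right (-1)
          simpa using this
        exact ((IsCoprime.pow_iff (m := 2) (n := 2) (by norm_num) (by norm_num)).1 (by
          rw [← pow_mul]; exact h2)).symm
      obtain ⟨m, n, h1, h2, h3, h4, h6, h5⟩ := hp.coprime_classification' hcop hc2 (by positivity)
      have hmn : 0 < m * n := by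
        have : 0 < b ^ 2 := by positivity
        nlinarith
      have hm : 0 < m := by
        rcases h5.lt_or_eq with h | h
        · exact h
        · rw [← h] at hmn; simp at hmn
      have hn : 0 < n := by
        by_contra hh
        nlinarith
      have key : ∃ k l r : ℤ, k ^ 4 = l ^ 4 + r ^ 2 ∧ l ≠ 0 ∧ r ≠ 0 ∧ k.natAbs < a.natAbs := by
        rcases h6 with h6 | h6
        · exact fq_step_even hm hn hap (by rwa [Int.gcd_comm]) h6.2 (b := b) (by linarith) (by linarith)
        · exact fq_step_even hn hm hap h4 h6.1 (b := b) (by linarith) (by linarith)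
      obtain ⟨k, l, r, e1, e2, e3, e4⟩ := key
      exact ih k.natAbs (by omega) k l r rfl e2 e3 e1
  · obtain ⟨g, hgd⟩ : ∃ g : ℤ, g = Int.gcd a b := ⟨_, rfl⟩
    obtain ⟨a', ha'⟩ : g ∣ a := hgd ▸ Int.gcd_dvd_left ..
    obtain ⟨b', hb'⟩ : g ∣ b := hgd ▸ Int.gcd_dvd_right ..
    have hg1 : 1 < g := by
      have : Int.gcd a b ≠ 0 := by
        intro h0
        rw [Int.gcd_eq_zero_iff] at h0; exact hb h0.2
      omega
    have hc' : g ^ 2 ∣ c := by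
      rw [← Int.pow_dvd_pow_iff (n := 2) (by norm_num)]
      refine ⟨a' ^ 4 - b' ^ 4, ?_⟩
      have : c ^ 2 = a ^ 4 - b ^ 4 := by linarith
      rw [this, ha', hb']; ring
    obtain ⟨c', hc'⟩ := hc'
    refine ih a'.natAbs ?_ a' b' c' rfl ?_ ?_ ?_
    · have ha0 : 0 < a' := by
        by_contra hh
        nlinarith
      have : a' < a := by nlinarith
      omega
    · rintro rfl; simp at hb'; exact hb hb'
    · rintro rfl; simp at hc'; exact hc hc'
    · have hg4 : g ^ 4 ≠ 0 := by positivity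
      apply mul_left_cancel₀ hg4
      rw [ha', hb', hc'] at h
      linarith

theorem fq_rat_four_sub {r z : ℚ} (h : r ^ 4 = 1 + z ^ 2) : z = 0 := by
  by_contra hz
  have h1 : (r.num * z.den : ℚ) ^ 4 = (r.den * z.den : ℚ) ^ 4 + (z.num * z.den * r.den ^ 2 : ℚ) ^ 2 := by
    have e1 : (r.num : ℚ) = r * r.den := (Rat.mul_den_eq_num r).symm
    have e2 : (z.num : ℚ) = z * z.den := (Rat.mul_den_eq_num z).symm
    rw [e1, e2]
    linear_combination (r.den ^ 4 * z.den ^ 4 : ℚ) * h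
  have h2 : (r.num * z.den : ℤ) ^ 4 = (r.den * z.den : ℤ) ^ 4 + (z.num * z.den * r.den ^ 2 : ℤ) ^ 2 := by
    exact_mod_cast h1
  have : z.num ≠ 0 := by simpa using hz
  exact fq_four_sub_aux _ _ _ _ rfl (by positivity) (by positivity) h2

theorem fq_rat_four_add {r z : ℚ} (h : r ^ 4 + 1 = z ^ 2) : r = 0 := by
  by_contra hz
  have h1 : (r.num * z.den : ℚ) ^ 4 + (r.den * z.den : ℚ) ^ 4 = (z.num * z.den * r.den ^ 2 : ℚ) ^ 2 := by
    have e1 : (r.num : ℚ) = r * r.den := (Rat.mul_den_eq_num r).symm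
    have e2 : (z.num : ℚ) = z * z.den := (Rat.mul_den_eq_num z).symm
    rw [e1, e2]
    linear_combination (r.den ^ 4 * z.den ^ 4 : ℚ) * h
  have h2 : (r.num * z.den : ℤ) ^ 4 + (r.den * z.den : ℤ) ^ 4 = (z.num * z.den * r.den ^ 2 : ℤ) ^ 2 := by
    exact_mod_cast h1
  have : r.num ≠ 0 := by simpa using hz
  exact not_fermat_42 (by positivity) (by positivity) h2

theorem fq_rat_not_sq_two (r : ℚ) : r ^ 2 ≠ 2 := by
  intro h
  have := Nat.prime_two.irrational_sqrt
  refine this ⟨|r|, ?_⟩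
  have h1 : ((|r| : ℚ) : ℝ) = |(r : ℝ)| := by push_cast; rfl
  have h2 : (r : ℝ) ^ 2 = 2 := by exact_mod_cast h
  rw [h1, ← Real.sqrt_sq_eq_abs, h2]
  norm_num

theorem fq_rat_E1 {x y : ℚ} (h : y ^ 2 = x ^ 3 - x) : y = 0 := by
  by_contra hy
  have h1 : ((x ^ 2 + 1) / (2 * y)) ^ 4 = 1 + ((x ^ 2 - 2 * x - 1) * (x ^ 2 + 2 * x - 1) / (4 * y ^ 2)) ^ 2 := by
    have e : y ^ 4 = (x ^ 3 - x) ^ 2 := by rw [← h]; ring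
    field_simp
    ring_nf
    ring_nf at e
    linear_combination (-256) * e
  have h2 := fq_rat_four_sub h1
  have h3 : (x ^ 2 - 2 * x - 1) * (x ^ 2 + 2 * x - 1) = 0 := by
    have : (4 * y ^ 2) ≠ 0 := by positivity
    rcases div_eq_zero_iff.1 h2 with h | h
    · exact h
    · exact absurd h this
  rcases mul_eq_zero.1 h3 with h4 | h4
  · exact fq_rat_not_sq_two (x - 1) (by linear_combination h4)
  · exact fq_rat_not_sq_two (x + 1) (by linear_combination h4)

theorem fq_rat_E2 {x y : ℚ} (h : 2 * y ^ 2 = x ^ 3 - x) : y = 0 := by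
  by_cases hx : x = 0
  · subst hx; simpa using h
  have h1 : (y / x) ^ 4 + 1 = ((x ^ 2 + 1) / (2 * x)) ^ 2 := by
    have e : 4 * y ^ 4 = (x ^ 3 - x) ^ 2 := by rw [← h]; ring
    field_simp
    linear_combination e
  have := fq_rat_four_add h1
  simpa [hx] using this

/-- The working description of the field `ℚ(ζ₈) = ℚ(i, √2)` used below. -/
structure FQData_s2 (L : Type*) [Field L] where
  i : L
  s : L
  σ : L →+* L
  τ : L →+* L
  hi : i ^ 2 = -1
  hs : s ^ 2 = 2
  σi : σ i = -i
  σs : σ s = s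
  τi : τ i = i
  τs : τ s = -s
  σσ : ∀ x, σ (σ x) = x
  ττ : ∀ x, τ (τ x) = x
  στ : ∀ x, σ (τ x) = τ (σ x)
  fixed : ∀ x, σ x = x → τ x = x → ∃ q : ℚ, x = (q : L)

namespace FQData_s2

variable {L : Type*} [Field L] [CharZero L] (D : FQData_s2 L)

theorem i_ne : D.i ≠ 0 := by
  intro h; have := D.hi; rw [h] at this; norm_num at this

theorem s_ne : D.s ≠ 0 := by
  intro h; have := D.hs; rw [h] at this; norm_num at this

theorem i_add_ne : (1 + D.i) ≠ 0 := by
  intro h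
  have := D.hi
  have e : (2 : L) = 0 := by linear_combination this + (1 - D.i) * h
  norm_num at e

theorem s_not_sq (z : L) : z ^ 2 ≠ D.s := by
  intro h
  have hb : (z * D.τ z) ^ 2 = (D.i * D.s) ^ 2 := by
    have : (D.τ z) ^ 2 = - D.s := by rw [← map_pow, h, D.τs]
    rw [mul_pow, mul_pow, h, this, D.hi]; ring
  have hf : D.τ (z * D.τ z) = z * D.τ z := by rw [map_mul, D.ττ]; ring
  have h0 : D.i * D.s ≠ 0 := mul_ne_zero D.i_ne D.s_ne
  apply h0
  rcases sq_eq_sq_iff_eq_or_eq_neg.1 hb with e | e <;> rw [e] at hf <;>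
    simp only [map_neg, map_mul, D.τi, D.τs] at hf
  · linear_combination (-1/2 : L) * hf
  · linear_combination (1/2 : L) * hf

/-- If `c` has norm `-1` to `ℚ(√-2)` then it is not a square. -/
theorem not_sq_of_norm {c : L} (hc : c * D.σ (D.τ c) = -1) (z : L) : z ^ 2 ≠ c := by
  intro h
  have hb : (z * D.σ (D.τ z)) ^ 2 = D.i ^ 2 := by
    rw [mul_pow, ← map_pow, ← map_pow, h, hc, D.hi]
  have hf : D.σ (D.τ (z * D.σ (D.τ z))) = z * D.σ (D.τ z) := by
    rw [map_mul, map_mul, ← D.στ, D.σσ, D.ττ]; ring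
  apply D.i_ne
  rcases sq_eq_sq_iff_eq_or_eq_neg.1 hb with e | e <;> rw [e] at hf <;>
    simp only [map_neg, D.τi, D.σi] at hf
  · linear_combination (-1/2 : L) * hf
  · linear_combination (1/2 : L) * hf

theorem one_add_s_not_sq (z : L) : z ^ 2 ≠ 1 + D.s := by
  apply D.not_sq_of_norm
  simp only [map_add, map_one, D.τs, map_neg, D.σs]
  linear_combination - D.hs

theorem one_add_i_not_sq (z : L) : z ^ 2 ≠ 1 + D.i := by
  intro h
  have hz : z ≠ 0 := by
    rintro rfl
    exact D.i_add_ne (by rw [← h]; ring)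
  apply D.one_add_s_not_sq ((1 + D.s * (1 + D.i) / 2) / z)
  rw [div_pow, div_eq_iff (by positivity), h]
  linear_combination ((1 + D.i) ^ 2 / 4) * D.hs + (1/2 : L) * D.hi

theorem one_sub_i_not_sq (z : L) : z ^ 2 ≠ 1 - D.i := by
  intro h
  apply D.one_add_i_not_sq (D.σ z)
  rw [← map_pow, h]; simp [D.σi]

/-- An element whose square is rational. -/
theorem sq_rat (D : FQData_s2 L) {b : L} {r : ℚ} (h : b ^ 2 = (r : L)) :
    ∃ q : ℚ, q ^ 2 = r ∨ q ^ 2 = -r ∨ q ^ 2 = 2 * r ∨ q ^ 2 = -2 * r := by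
  have h1 : (D.σ b) ^ 2 = b ^ 2 := by rw [← map_pow, h, map_ratCast]
  have h2 : (D.τ b) ^ 2 = b ^ 2 := by rw [← map_pow, h, map_ratCast]
  rcases sq_eq_sq_iff_eq_or_eq_neg.1 h1 with e1 | e1 <;>
  rcases sq_eq_sq_iff_eq_or_eq_neg.1 h2 with e2 | e2
  · obtain ⟨q, hq⟩ := D.fixed b e1 e2
    refine ⟨q, Or.inl ?_⟩
    have : ((q ^ 2 : ℚ) : L) = (r : L) := by push_cast; rw [← hq, h]
    exact_mod_cast this
  · obtain ⟨q, hq⟩ := D.fixed (b * D.s) (by rw [map_mul, e1, D.σs]) (by rw [map_mul, e2, D.τs]; ring)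
    refine ⟨q, Or.inr (Or.inr (Or.inl ?_))⟩
    have : ((q ^ 2 : ℚ) : L) = ((2 * r : ℚ) : L) := by
      push_cast; rw [← hq, mul_pow, h, D.hs]; ring
    exact_mod_cast this
  · obtain ⟨q, hq⟩ := D.fixed (b * D.i) (by rw [map_mul, e1, D.σi]; ring) (by rw [map_mul, e2, D.τi])
    refine ⟨q, Or.inr (Or.inl ?_)⟩
    have : ((q ^ 2 : ℚ) : L) = ((-r : ℚ) : L) := by
      push_cast; rw [← hq, mul_pow, h, D.hi]; ring
    exact_mod_cast this
  · obtain ⟨q, hq⟩ := D.fixed (b * D.i * D.s) (by rw [map_mul, map_mul, e1, D.σi, D.σs]; ring)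
      (by rw [map_mul, map_mul, e2, D.τi, D.τs]; ring)
    refine ⟨q, Or.inr (Or.inr (Or.inr ?_))⟩
    have : ((q ^ 2 : ℚ) : L) = ((-2 * r : ℚ) : L) := by
      push_cast; rw [← hq, mul_pow, mul_pow, h, D.hi, D.hs]; ring
    exact_mod_cast this

theorem five_not_sq (D : FQData_s2 L) (b : L) : b ^ 2 ≠ 5 := by
  intro h
  have h' : b ^ 2 = ((5 : ℚ) : L) := by rw [h]; norm_num
  obtain ⟨q, hq⟩ := D.sq_rat h'
  have key : ∀ n : ℕ, (∀ m : ℕ, m ≤ 10 → m * m ≠ n) → n ≤ 10 → q ^ 2 ≠ (n : ℚ) := by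
    intro n hn hn10 hqn
    have : IsSquare (n : ℚ) := ⟨q, by rw [← hqn]; ring⟩
    rw [Rat.isSquare_natCast_iff] at this
    obtain ⟨m, hm⟩ := this
    refine hn m ?_ hm.symm
    by_contra hh
    nlinarith
  have h5 := key 5 (by decide) (by norm_num)
  have h10 := key 10 (by decide) (by norm_num)
  push_cast at h5 h10
  rcases hq with hq | hq | hq | hq
  · exact h5 hq
  · nlinarith [sq_nonneg q]
  · apply h10; linarith
  · nlinarith [sq_nonneg q]

end FQData_s2

open scoped WeierstrassCurve

/-- The curve `y² = x³ - x`. -/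
def fqE : WeierstrassCurve ℚ := ⟨0, 0, 0, -1, 0⟩

section
variable {L : Type*} [Field L] [CharZero L]

theorem fqE_eq {x y : L} : (fqE⁄L).toAffine.Equation x y ↔ y ^ 2 = x ^ 3 - x := by
  rw [WeierstrassCurve.Affine.equation_iff]
  simp [fqE]
  constructor <;> intro h <;> linear_combination h

theorem fqE_nonsing {x y : L} : (fqE⁄L).toAffine.Nonsingular x y ↔ y ^ 2 = x ^ 3 - x := by
  rw [WeierstrassCurve.Affine.nonsingular_iff', fqE_eq]
  simp [fqE]
  intro h
  by_cases hy : y = 0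
  · left
    subst hy
    intro h2
    have : x ≠ 0 := by rintro rfl; norm_num at h2
    have h3 : x ^ 2 = 1 := by
      have : x * (x ^ 2 - 1) = 0 := by linear_combination -h
      rcases mul_eq_zero.1 this with h | h
      · contradiction
      · linear_combination h
    rw [h3] at h2; norm_num at h2
  · right; exact hy

open Classical in
theorem fqE_dbl {x y : L} (h : (fqE⁄L).toAffine.Nonsingular x y) (hy : y ≠ 0) :
    ∃ X Y h', WeierstrassCurve.Affine.Point.some x y h + WeierstrassCurve.Affine.Point.some x y h
      = WeierstrassCurve.Affine.Point.some X Y h' ∧ X = ((x ^ 2 + 1) / (2 * y)) ^ 2 ∧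
      X - 1 = ((x ^ 2 - 2 * x - 1) / (2 * y)) ^ 2 ∧ X + 1 = ((x ^ 2 + 2 * x - 1) / (2 * y)) ^ 2 := by
  have hn : y ≠ (fqE⁄L).toAffine.negY x y := by
    simp [WeierstrassCurve.Affine.negY, fqE]
    intro h; apply hy; linear_combination (1/2 : L) * h
  refine ⟨_, _, _, WeierstrassCurve.Affine.Point.add_self_of_Y_ne hn, ?_⟩
  have e := fqE_nonsing.1 h
  rw [WeierstrassCurve.Affine.slope_of_Y_ne rfl hn]
  simp [WeierstrassCurve.Affine.addX, WeierstrassCurve.Affine.negY, fqE]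
  have hy2 : y + y ≠ 0 := by rw [← two_mul]; exact mul_ne_zero two_ne_zero hy
  refine ⟨?_, ?_, ?_⟩ <;> field_simp <;> ring_nf <;> simp only [show y ^ 2 = x ^ 3 - x from e] <;> ring

end

set_option linter.unusedSectionVars false

section
variable {L : Type*} [Field L] [CharZero L]

theorem fq_eigen_y {x y c : L} (h : y ^ 2 = x ^ 3 - x) {q r : ℚ} (hx : x = q) (hy : y = c * r)
    (hc : c ^ 2 = 1 ∨ c ^ 2 = -1 ∨ c ^ 2 = 2 ∨ c ^ 2 = -2) : y = 0 := by
  suffices r = 0 by rw [hy, this]; simp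
  rw [hx, hy, mul_pow] at h
  rcases hc with hc | hc | hc | hc <;> rw [hc] at h
  · apply fq_rat_E1 (x := q)
    have : ((r ^ 2 : ℚ) : L) = ((q ^ 3 - q : ℚ) : L) := by push_cast; linear_combination h
    exact_mod_cast this
  · apply fq_rat_E1 (x := -q)
    have : ((r ^ 2 : ℚ) : L) = (((-q) ^ 3 - (-q) : ℚ) : L) := by push_cast; linear_combination -h
    exact_mod_cast this
  · apply fq_rat_E2 (x := q)
    have : ((2 * r ^ 2 : ℚ) : L) = ((q ^ 3 - q : ℚ) : L) := by push_cast; linear_combination h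
    exact_mod_cast this
  · apply fq_rat_E2 (x := -q)
    have : ((2 * r ^ 2 : ℚ) : L) = (((-q) ^ 3 - (-q) : ℚ) : L) := by push_cast; linear_combination -h
    exact_mod_cast this

open Classical in
theorem fqE_two_tors {x y : L} (h : (fqE⁄L).toAffine.Nonsingular x y) (hy : y = 0) :
    WeierstrassCurve.Affine.Point.some x y h + WeierstrassCurve.Affine.Point.some x y h = 0 := by
  apply WeierstrassCurve.Affine.Point.add_self_of_Y_eq
  simp [WeierstrassCurve.Affine.negY, fqE, hy]

open Classical in
theorem fqE_eigen (D : FQData_s2 L) (P : (fqE⁄L).toAffine.Point)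
    (h1 : WeierstrassCurve.Affine.Point.map (W' := fqE) D.σ.toRatAlgHom P = P ∨
      WeierstrassCurve.Affine.Point.map (W' := fqE) D.σ.toRatAlgHom P = -P)
    (h2 : WeierstrassCurve.Affine.Point.map (W' := fqE) D.τ.toRatAlgHom P = P ∨
      WeierstrassCurve.Affine.Point.map (W' := fqE) D.τ.toRatAlgHom P = -P) : P + P = 0 := by
  rcases P with _ | ⟨x, y, h⟩
  · rfl
  apply fqE_two_tors
  have e := fqE_nonsing.1 h
  have g1 : D.σ x = x ∧ (D.σ y = y ∨ D.σ y = -y) := by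
    rw [WeierstrassCurve.Affine.Point.map_some, WeierstrassCurve.Affine.Point.neg_some] at h1
    rcases h1 with h1 | h1
    · obtain ⟨a, b⟩ := WeierstrassCurve.Affine.Point.some.inj h1
      exact ⟨a, Or.inl b⟩
    · obtain ⟨a, b⟩ := WeierstrassCurve.Affine.Point.some.inj h1
      refine ⟨a, Or.inr ?_⟩
      simpa [WeierstrassCurve.Affine.negY, fqE] using b
  have g2 : D.τ x = x ∧ (D.τ y = y ∨ D.τ y = -y) := by
    rw [WeierstrassCurve.Affine.Point.map_some, WeierstrassCurve.Affine.Point.neg_some] at h2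
    rcases h2 with h2 | h2
    · obtain ⟨a, b⟩ := WeierstrassCurve.Affine.Point.some.inj h2
      exact ⟨a, Or.inl b⟩
    · obtain ⟨a, b⟩ := WeierstrassCurve.Affine.Point.some.inj h2
      refine ⟨a, Or.inr ?_⟩
      simpa [WeierstrassCurve.Affine.negY, fqE] using b
  obtain ⟨q, hq⟩ := D.fixed x g1.1 g2.1
  have hi := D.i_ne
  have hs := D.s_ne
  rcases g1.2 with e1 | e1 <;> rcases g2.2 with e2 | e2
  · obtain ⟨r, hr⟩ := D.fixed y e1 e2
    exact fq_eigen_y e hq (c := 1) (r := r) (by rw [hr]; simp) (by simp)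
  · obtain ⟨r, hr⟩ := D.fixed (y / D.s) (by rw [map_div₀, e1, D.σs]) (by rw [map_div₀, e2, D.τs]; field_simp)
    exact fq_eigen_y e hq (c := D.s) (r := r) (by rw [← hr]; field_simp) (by simp [D.hs])
  · obtain ⟨r, hr⟩ := D.fixed (y / D.i) (by rw [map_div₀, e1, D.σi]; field_simp) (by rw [map_div₀, e2, D.τi])
    exact fq_eigen_y e hq (c := D.i) (r := r) (by rw [← hr]; field_simp) (by simp [D.hi])
  · obtain ⟨r, hr⟩ := D.fixed (y / (D.i * D.s)) (by rw [map_div₀, map_mul, e1, D.σi, D.σs]; field_simp)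
      (by rw [map_div₀, map_mul, e2, D.τi, D.τs]; field_simp)
    exact fq_eigen_y e hq (c := D.i * D.s) (r := r) (by rw [← hr]; field_simp) (by simp [D.hi, D.hs, mul_pow])

open Classical in
theorem fqE_eight (D : FQData_s2 L) (P : (fqE⁄L).toAffine.Point) :
    (((P + P) + (P + P)) + ((P + P) + (P + P))) = 0 := by
  set f := WeierstrassCurve.Affine.Point.map (W' := fqE) D.σ.toRatAlgHom with hf
  set g := WeierstrassCurve.Affine.Point.map (W' := fqE) D.τ.toRatAlgHom with hg
  have ff : ∀ P, f (f P) = P := by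
    rintro (_ | ⟨x, y, h⟩)
    · rfl
    · rw [hf, WeierstrassCurve.Affine.Point.map_some, WeierstrassCurve.Affine.Point.map_some]
      simp [D.σσ]
  have gg : ∀ P, g (g P) = P := by
    rintro (_ | ⟨x, y, h⟩)
    · rfl
    · rw [hg, WeierstrassCurve.Affine.Point.map_some, WeierstrassCurve.Affine.Point.map_some]
      simp [D.ττ]
  have fg : ∀ P, g (f P) = f (g P) := by
    rintro (_ | ⟨x, y, h⟩)
    · rfl
    · rw [hg, hf, WeierstrassCurve.Affine.Point.map_some, WeierstrassCurve.Affine.Point.map_some,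
        WeierstrassCurve.Affine.Point.map_some, WeierstrassCurve.Affine.Point.map_some]
      simp [D.στ]
  have k1 := fqE_eigen D (P + f P + g P + f (g P))
    (Or.inl (by rw [← hf]; simp only [map_add, ff]; abel))
    (Or.inl (by rw [← hg]; simp only [map_add, fg, gg]; abel))
  have k2 := fqE_eigen D (P + f P - g P - f (g P))
    (Or.inl (by rw [← hf]; simp only [map_add, map_sub, ff]; abel))
    (Or.inr (by rw [← hg]; simp only [map_add, map_sub, fg, gg]; abel))
  have k3 := fqE_eigen D (P - f P + g P - f (g P))
    (Or.inr (by rw [← hf]; simp only [map_add, map_sub, ff]; abel))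
    (Or.inl (by rw [← hg]; simp only [map_add, map_sub, fg, gg]; abel))
  have k4 := fqE_eigen D (P - f P - g P + f (g P))
    (Or.inr (by rw [← hf]; simp only [map_add, map_sub, ff]; abel))
    (Or.inr (by rw [← hg]; simp only [map_add, map_sub, fg, gg]; abel))
  have := congrArg₂ (· + ·) (congrArg₂ (· + ·) k1 k2) (congrArg₂ (· + ·) k3 k4)
  simp only [add_zero] at this
  rw [← this]; abel

/-- `y = 0`, `x = ±i` or `x = ±1 ± √2`. -/
def FQList (x : L) : Prop := x ^ 2 = -1 ∨ x ^ 2 = 2 * x + 1 ∨ x ^ 2 = - 2 * x + 1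

theorem FQData_s2.sq_eq_two (D : FQData_s2 L) {z : L} (h : z ^ 2 = 2) : z = D.s ∨ z = -D.s :=
  sq_eq_sq_iff_eq_or_eq_neg.1 (by rw [h, D.hs])

theorem FQData_s2.sq_eq_neg_one (D : FQData_s2 L) {z : L} (h : z ^ 2 = -1) : z = D.i ∨ z = -D.i :=
  sq_eq_sq_iff_eq_or_eq_neg.1 (by rw [h, D.hi])

theorem FQData_s2.neg_s_not_sq (D : FQData_s2 L) (z : L) : z ^ 2 ≠ -D.s := by
  intro h
  apply D.s_not_sq (D.i * z)
  rw [mul_pow, h, D.hi]; ring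

open Classical in
/-- the affine points of `y² = x³ - x` over `ℚ(ζ₈)` -/
theorem fqE_points (D : FQData_s2 L) {x y : L} (h : y ^ 2 = x ^ 3 - x) : y = 0 ∨ FQList x := by
  by_cases hy : y = 0
  · exact Or.inl hy
  right
  have hh := fqE_nonsing.2 h
  obtain ⟨X, Y, hX, hd, e1, e2, e3⟩ := fqE_dbl hh hy
  by_cases hY : Y = 0
  · have := fqE_nonsing.1 hX
    rw [hY] at this
    have h3 : X * (X - 1) * (X + 1) = 0 := by linear_combination -this
    have h2y : 2 * y ≠ 0 := mul_ne_zero two_ne_zero hy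
    rcases mul_eq_zero.1 h3 with h3 | h3
    · rcases mul_eq_zero.1 h3 with h3 | h3
      · rw [h3] at e1
        have := (div_eq_zero_iff.1 (pow_eq_zero_iff two_ne_zero |>.1 e1.symm)).resolve_right h2y
        left; linear_combination this
      · rw [h3] at e2
        have := (div_eq_zero_iff.1 (pow_eq_zero_iff two_ne_zero |>.1 e2.symm)).resolve_right h2y
        right; left; linear_combination this
    · rw [h3] at e3
      have := (div_eq_zero_iff.1 (pow_eq_zero_iff two_ne_zero |>.1 e3.symm)).resolve_right h2y
      right; right; linear_combination this
  · exfalso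
    have h8 := fqE_eight D (WeierstrassCurve.Affine.Point.some x y hh)
    rw [hd] at h8
    obtain ⟨X2, Y2, hX2, hd2, f1, f2, f3⟩ := fqE_dbl hX hY
    rw [hd2] at h8
    have hY2 : Y2 = 0 := by
      by_contra hY2
      obtain ⟨X3, Y3, hX3, hd3, -⟩ := fqE_dbl hX2 hY2
      rw [hd3] at h8
      exact WeierstrassCurve.Affine.Point.some_ne_zero _ h8
    have := fqE_nonsing.1 hX2
    rw [hY2] at this
    have h3 : X2 * (X2 - 1) * (X2 + 1) = 0 := by linear_combination -this
    have h2y : 2 * Y ≠ 0 := mul_ne_zero two_ne_zero hY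
    rcases mul_eq_zero.1 h3 with h3 | h3
    · rcases mul_eq_zero.1 h3 with h3 | h3
      · rw [h3] at f1
        have := (div_eq_zero_iff.1 (pow_eq_zero_iff two_ne_zero |>.1 f1.symm)).resolve_right h2y
        rcases D.sq_eq_neg_one (z := X) (by linear_combination this) with h | h
        · exact D.one_add_i_not_sq _ (by rw [← e3, h]; ring)
        · exact D.one_sub_i_not_sq _ (by rw [← e3, h]; ring)
      · rw [h3] at f2
        have := (div_eq_zero_iff.1 (pow_eq_zero_iff two_ne_zero |>.1 f2.symm)).resolve_right h2y
        rcases D.sq_eq_two (z := X - 1) (by linear_combination this) with h | h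
        · exact D.s_not_sq _ (by rw [← e2, h])
        · exact D.neg_s_not_sq _ (by rw [← e2, h])
    · rw [h3] at f3
      have := (div_eq_zero_iff.1 (pow_eq_zero_iff two_ne_zero |>.1 f3.symm)).resolve_right h2y
      rcases D.sq_eq_two (z := X + 1) (by linear_combination this) with h | h
      · exact D.s_not_sq _ (by rw [← e3, h])
      · exact D.neg_s_not_sq _ (by rw [← e3, h])

end

section
variable {L : Type*} [Field L] [CharZero L]

theorem FQData_s2.isSq_pm_one (D : FQData_s2 L) {c : L} (h : c ^ 2 = 1) : ∃ g, c = g ^ 2 := by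
  rcases sq_eq_sq_iff_eq_or_eq_neg.1 (show _ ^ 2 = (1 : L) ^ 2 by rw [h]; ring) with h | h
  · exact ⟨1, by rw [h]; ring⟩
  · exact ⟨D.i, by rw [h, D.hi]⟩

theorem FQData_s2.isSq_pm_i (D : FQData_s2 L) {c : L} (h : c ^ 2 = -1) : ∃ g, c = g ^ 2 := by
  have hs := D.s_ne
  have h1 := D.hs
  have h2 := D.hi
  rcases D.sq_eq_neg_one h with h | h
  · refine ⟨(1 + D.i) / D.s, ?_⟩
    rw [h, div_pow, h1]; linear_combination (-1/2 : L) * h2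
  · refine ⟨(1 - D.i) / D.s, ?_⟩
    rw [h, div_pow, h1]; linear_combination (-1/2 : L) * h2

/-- shape of the quadratic irrational `±(1 + w)`, `w² = 2` -/
theorem fq_U_form {t : L} (h : t ^ 2 = 2 * t + 1 ∨ t ^ 2 = -2 * t + 1) :
    ∃ ε w : L, ε ^ 2 = 1 ∧ w ^ 2 = 2 ∧ t = ε * (1 + w) := by
  rcases h with h | h
  · exact ⟨1, t - 1, by ring, by linear_combination h, by ring⟩
  · exact ⟨-1, -t - 1, by ring, by linear_combination h, by ring⟩

theorem FQData_s2.tau_w (D : FQData_s2 L) {w : L} (h : w ^ 2 = 2) : D.τ w = -w ∧ D.σ w = w := by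
  rcases D.sq_eq_two h with h | h <;> rw [h] <;> simp [D.τs, D.σs]

theorem FQData_s2.sig_eps (D : FQData_s2 L) {w : L} (h : w ^ 2 = 1) : D.τ w = w ∧ D.σ w = w := by
  rcases sq_eq_sq_iff_eq_or_eq_neg.1 (show _ ^ 2 = (1 : L) ^ 2 by rw [h]; ring) with h | h <;> rw [h] <;> simp

theorem FQData_s2.U_not_sq (D : FQData_s2 L) {ε w : L} (h : ε ^ 2 = 1) (hw : w ^ 2 = 2) (z : L) :
    z ^ 2 ≠ ε * (1 + w) := by
  apply D.not_sq_of_norm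
  simp only [map_mul, map_add, map_one, (D.tau_w hw).1, (D.tau_w hw).2, (D.sig_eps h).1,
    (D.sig_eps h).2, map_neg]
  linear_combination (1 - w ^ 2) * h - hw

theorem FQData_s2.iU_not_sq (D : FQData_s2 L) {ε w : L} (h : ε ^ 2 = 1) (hw : w ^ 2 = 2) (z : L) :
    z ^ 2 ≠ D.i * ε * (1 + w) := by
  apply D.not_sq_of_norm
  simp only [map_mul, map_add, map_one, (D.tau_w hw).1, (D.tau_w hw).2, (D.sig_eps h).1,
    (D.sig_eps h).2, map_neg, D.τi, D.σi]
  linear_combination (- ε ^ 2 * (1 - w ^ 2)) * D.hi + (1 - w ^ 2) * h - hw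

theorem FQData_s2.w_not_sq (D : FQData_s2 L) {ε w : L} (h : ε ^ 2 = 1) (hw : w ^ 2 = 2) (z : L) :
    z ^ 2 ≠ ε * w := by
  intro hz
  have h1 : (ε * w) ^ 2 = 2 := by rw [mul_pow, h, hw]; ring
  rcases D.sq_eq_two h1 with h2 | h2
  · exact D.s_not_sq z (by rw [hz, h2])
  · exact D.neg_s_not_sq z (by rw [hz, h2])

/-- `k + w` with `k = ±1, ±3` is not a square -/
theorem FQData_s2.kw_not_sq (D : FQData_s2 L) (h7 : ∀ b : L, b ^ 2 ≠ 7) {k w : L} (hw : w ^ 2 = 2)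
    (hk : k = 1 ∨ k = -1 ∨ k = 3 ∨ k = -3) (z : L) : z ^ 2 ≠ k + w := by
  intro hz
  have hk1 : D.τ k = k := by rcases hk with h | h | h | h <;> subst h <;> simp [map_ofNat]
  have hk2 : D.σ k = k := by rcases hk with h | h | h | h <;> subst h <;> simp [map_ofNat]
  have hk3 : k ^ 2 = 1 ∨ k ^ 2 = 9 := by
    rcases hk with h | h | h | h <;> rw [h] <;> norm_num
  rcases hk3 with h | h
  · refine D.not_sq_of_norm ?_ z hz
    simp only [map_add, hk1, hk2, (D.tau_w hw).1, (D.tau_w hw).2, map_neg]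
    linear_combination h - hw
  · apply h7 (z * D.τ z)
    rw [mul_pow, ← map_pow, hz, map_add, hk1, (D.tau_w hw).1]
    linear_combination h - hw

/-- points on `y² = x³ + x` -/
theorem fqE_points' (D : FQData_s2 L) {x y : L} (h : y ^ 2 = x ^ 3 + x) :
    (y = 0) ∨ x ^ 2 = 1 ∨ ∃ ε w : L, ε ^ 2 = 1 ∧ w ^ 2 = 2 ∧ x = D.i * ε * (1 + w) := by
  obtain ⟨g, hg⟩ := D.isSq_pm_i D.hi
  have hg0 : g ≠ 0 := by
    rintro rfl; exact D.i_ne (by rw [hg]; ring)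
  have hi := D.hi
  have e : (g * y) ^ 2 = (-D.i * x) ^ 3 - (-D.i * x) := by
    rw [mul_pow, ← hg]
    linear_combination D.i * h + D.i * x ^ 3 * hi
  rcases fqE_points D e with h1 | h1 | h1
  · left; exact (mul_eq_zero.1 h1).resolve_left hg0
  · right; left; linear_combination -h1 + x ^ 2 * hi
  · right; right
    obtain ⟨ε, w, h2, h3, h4⟩ := fq_U_form h1
    refine ⟨ε, w, h2, h3, ?_⟩
    linear_combination D.i * h4 + x * hi

theorem fqE_points'' (D : FQData_s2 L) {x y : L} (h : y ^ 2 = x ^ 3 - x) :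
    (y = 0) ∨ x ^ 2 = -1 ∨ ∃ ε w : L, ε ^ 2 = 1 ∧ w ^ 2 = 2 ∧ x = ε * (1 + w) := by
  rcases fqE_points D h with h1 | h1 | h1
  · exact Or.inl h1
  · exact Or.inr (Or.inl h1)
  · exact Or.inr (Or.inr (fq_U_form h1))

/-- conclusion of the case analysis -/
def FQConc (p q : L) : Prop := ∃ c : L, p ^ 2 - 4 * q = c ^ 2 ∨ p ^ 2 - 4 * q = 3 * c ^ 2 ∨
  p ^ 2 - 4 * q = 7 * c ^ 2

theorem FQConc.of_zero {p q : L} (h : q = 0) : FQConc p q := ⟨p, Or.inl (by rw [h]; ring)⟩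

/-- both `s₀ = s₁ = 0` -/
theorem fq_case_a (D : FQData_s2 L) {p q t0 t1 m n : L} (h0 : t0 = 0 ∨ t0 ^ 2 = 1)
    (h1 : t1 = 0 ∨ t1 ^ 2 = -1) (hp0 : p = m ^ 2 - t0) (hp1 : p = n ^ 2 - t1)
    (hq0 : q = t0 ^ 2 - 1 + m ^ 2 * t0) (hq1 : q = t1 ^ 2 + 1 + n ^ 2 * t1) : FQConc p q := by
  rcases h0 with h0 | h0 <;> rcases h1 with h1 | h1
  · exfalso
    subst h0; subst h1
    have : (2 : L) = 0 := by linear_combination hq0 - hq1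
    norm_num at this
  · subst h0
    have hn : n ^ 2 = t1 := by
      linear_combination t1 * hq1 - t1 * hq0 + (n ^ 2 + t1) * h1
    refine ⟨2, Or.inl ?_⟩
    rw [hq0, hp1, hn]; ring
  · subst h1
    have hm : m ^ 2 = t0 := by
      linear_combination t0 * hq1 - t0 * hq0 - (m ^ 2 + t0) * h0
    refine ⟨2 * D.i, Or.inl ?_⟩
    rw [hq1, hp0, hm]; linear_combination -4 * D.hi
  · have hm : m ^ 2 = p + t0 := by linear_combination -hp0
    have hn : n ^ 2 = p + t1 := by linear_combination -hp1
    have hp : p = - (t0 + t1) := by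
      have e : p * (t0 - t1) + 2 = 0 := by
        rw [hm] at hq0; rw [hn] at hq1
        linear_combination hq1 - hq0 - 2 * h0 + 2 * h1
      linear_combination (1/2 : L) * (t0 + t1) * e - (1/2 : L) * p * h0 + (1/2 : L) * p * h1
    have hq : q = - t0 * t1 := by
      rw [hq0, hm, hp]; linear_combination h0
    obtain ⟨g, hg⟩ := D.isSq_pm_i (c := t0 * t1) (by rw [mul_pow, h0, h1]; ring)
    refine ⟨D.s * g, Or.inr (Or.inl ?_)⟩
    rw [mul_pow, D.hs, ← hg, hp, hq]; linear_combination h0 + h1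

theorem fq_case_b (D : FQData_s2 L) {p q t0 t1 s1 m n : L} (h0 : t0 = 0 ∨ t0 ^ 2 = 1)
    (h1 : t1 ^ 2 = 1) (hs1 : s1 ^ 2 = t1 ^ 3 + t1) (hp0 : p = m ^ 2 - t0) (hp1 : p = n ^ 2 - t1)
    (hq0 : q = t0 ^ 2 - 1 + m ^ 2 * t0) (hq1 : q = t1 ^ 2 + 1 - 2 * s1 * n + n ^ 2 * t1) :
    FQConc p q := by
  have hi := D.hi
  have hm : m ^ 2 = p + t0 := by linear_combination -hp0
  have hn : n ^ 2 = p + t1 := by linear_combination -hp1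
  have hs2 : s1 ^ 2 = 2 * t1 := by rw [hs1]; linear_combination t1 * h1
  have hsn : (s1 * n) ^ 2 = 2 * t1 * p + 2 := by
    rw [mul_pow, hs2, hn]; linear_combination 2 * h1
  rw [hm] at hq0
  rw [hn] at hq1
  rcases h0 with h0 | h0
  · exfalso
    subst h0
    have e : 2 * (s1 * n) = 4 + p * t1 := by linear_combination hq1 - hq0 + 2 * h1
    have e2 : p ^ 2 = -8 := by
      have : (2 * (s1 * n)) ^ 2 = (4 + p * t1) ^ 2 := by rw [e]
      linear_combination -this + 4 * hsn - p ^ 2 * h1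
    have e3 : (m ^ 2 / (2 * D.i)) ^ 2 = 2 := by
      rw [hm, div_pow, mul_pow, hi, add_zero, e2]; norm_num
    have h1i := D.i_add_ne
    have hii := D.i_ne
    refine D.w_not_sq (ε := 1) (by ring) e3 (m / (1 + D.i)) ?_
    field_simp
    linear_combination (-m ^ 2) * hi
  · have hsplit : (t0 - t1) * (t0 + t1) = 0 := by linear_combination h0 - h1
    rcases mul_eq_zero.1 hsplit with h | h
    · have ht : t0 = t1 := by linear_combination h
      subst ht
      have e : s1 * n = 1 := by linear_combination (1/2 : L) * (hq1 - hq0)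
      rw [e] at hsn
      have hp : p = - t0 / 2 := by linear_combination (-t0/2) * hsn - p * h0
      refine ⟨D.i / 2, Or.inr (Or.inr ?_)⟩
      rw [hq0, hp]
      linear_combination (-7/4 : L) * hi - (23/4 : L) * h0
    · have ht : t0 = -t1 := by linear_combination h
      subst ht
      have e : s1 * n = 1 + p * t1 := by
        linear_combination (1/2 : L) * (hq1 - hq0)
      rw [e] at hsn
      have hp : p ^ 2 = 1 := by linear_combination hsn - p ^ 2 * h1
      have hsplit : (p - t1) * (p + t1) = 0 := by linear_combination hp - h1
      rcases mul_eq_zero.1 hsplit with h | h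
      · apply FQConc.of_zero
        rw [hq0]; linear_combination (-t1) * h + h1
      · have hp : p = -t1 := by linear_combination h
        refine ⟨D.i, Or.inr (Or.inr ?_)⟩
        rw [hq0, hp]
        linear_combination (-7 : L) * hi - 11 * h1

theorem fq_case_c (D : FQData_s2 L) {p q t0 t1 s0 m n : L} (h0 : t0 ^ 2 = -1)
    (h1 : t1 = 0 ∨ t1 ^ 2 = -1) (hs0 : s0 ^ 2 = t0 ^ 3 - t0) (hp0 : p = m ^ 2 - t0) (hp1 : p = n ^ 2 - t1)
    (hq0 : q = t0 ^ 2 - 1 - 2 * s0 * m + m ^ 2 * t0) (hq1 : q = t1 ^ 2 + 1 + n ^ 2 * t1) :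
    FQConc p q := by
  have hm : m ^ 2 = p + t0 := by linear_combination -hp0
  have hn : n ^ 2 = p + t1 := by linear_combination -hp1
  have hs2 : s0 ^ 2 = -2 * t0 := by rw [hs0]; linear_combination t0 * h0
  have hsn : (s0 * m) ^ 2 = -2 * t0 * p + 2 := by
    rw [mul_pow, hs2, hm]; linear_combination -2 * h0
  rw [hm] at hq0
  rw [hn] at hq1
  rcases h1 with h1 | h1
  · exfalso
    subst h1
    have e : 2 * (s0 * m) = p * t0 - 4 := by linear_combination hq0 - hq1 + 2 * h0
    have e2 : p ^ 2 = 8 := by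
      have : (2 * (s0 * m)) ^ 2 = (p * t0 - 4) ^ 2 := by rw [e]
      linear_combination this - 4 * hsn + p ^ 2 * h0
    have e3 : (n ^ 2 / 2) ^ 2 = 2 := by
      rw [hn, div_pow, add_zero, e2]; norm_num
    have hss := D.s_ne
    refine D.w_not_sq (ε := 1) (by ring) e3 (n / D.s) ?_
    rw [div_pow, D.hs]; ring
  · have hsplit : (t0 - t1) * (t0 + t1) = 0 := by linear_combination h0 - h1
    rcases mul_eq_zero.1 hsplit with h | h
    · have ht : t1 = t0 := by linear_combination -h
      subst ht
      have e : s0 * m = -1 := by linear_combination (1/2 : L) * (hq0 - hq1)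
      rw [e] at hsn
      have hp : p = - t1 / 2 := by linear_combination (-t1/2) * hsn + p * h0
      refine ⟨1 / 2, Or.inr (Or.inr ?_)⟩
      rw [hq1, hp]
      linear_combination (-23/4 : L) * h1
    · have ht : t1 = -t0 := by linear_combination h
      subst ht
      have e : s0 * m = p * t0 - 1 := by
        linear_combination (1/2 : L) * (hq0 - hq1)
      rw [e] at hsn
      have hp : p ^ 2 = -1 := by linear_combination -hsn + p ^ 2 * h0
      have hsplit : (p - t0) * (p + t0) = 0 := by linear_combination hp - h0
      rcases mul_eq_zero.1 hsplit with h | h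
      · apply FQConc.of_zero
        rw [hq1]; linear_combination (-t0) * h + h0
      · have hp : p = -t0 := by linear_combination h
        refine ⟨1, Or.inr (Or.inr ?_)⟩
        rw [hq1, hp]
        linear_combination - 11 * h0

theorem fq_case_d (D : FQData_s2 L) (hL3 : ∀ b : L, b ^ 2 ≠ 3) {p q t0 t1 s0 s1 m n : L}
    (h0 : t0 ^ 2 = -1) (h1 : t1 ^ 2 = 1)
    (hs0 : s0 ^ 2 = t0 ^ 3 - t0) (hs1 : s1 ^ 2 = t1 ^ 3 + t1)
    (hp0 : p = m ^ 2 - t0) (hp1 : p = n ^ 2 - t1)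
    (hq0 : q = t0 ^ 2 - 1 - 2 * s0 * m + m ^ 2 * t0)
    (hq1 : q = t1 ^ 2 + 1 - 2 * s1 * n + n ^ 2 * t1) :
    FQConc p q := by
  have hm : m ^ 2 = p + t0 := by linear_combination -hp0
  have hn : n ^ 2 = p + t1 := by linear_combination -hp1
  have hs2 : s0 ^ 2 = -2 * t0 := by rw [hs0]; linear_combination t0 * h0
  have hs2' : s1 ^ 2 = 2 * t1 := by rw [hs1]; linear_combination t1 * h1
  rw [hm] at hq0
  rw [hn] at hq1
  obtain ⟨A, hA⟩ : ∃ A, A = s0 * m := ⟨_, rfl⟩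
  obtain ⟨B, hB⟩ : ∃ B, B = s1 * n := ⟨_, rfl⟩
  have hA2 : A ^ 2 = -2 * t0 * p + 2 := by
    rw [hA, mul_pow, hs2, hm]; linear_combination -2 * h0
  have hB2 : B ^ 2 = 2 * t1 * p + 2 := by
    rw [hB, mul_pow, hs2', hn]; linear_combination 2 * h1
  have hq0' : q = -3 - 2 * A + p * t0 := by rw [hA]; linear_combination hq0 + 2 * h0
  have hq1' : q = 3 - 2 * B + p * t1 := by rw [hB]; linear_combination hq1 + 2 * h1
  obtain ⟨γ, hγ⟩ : ∃ γ, γ = t0 * t1 := ⟨_, rfl⟩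
  have hγ2 : γ ^ 2 = -1 := by rw [hγ, mul_pow, h0, h1]; ring
  have hγ0 : γ * t0 = -t1 := by rw [hγ]; linear_combination t1 * h0
  have hγ1 : γ * t1 = t0 := by rw [hγ]; linear_combination t0 * h1
  have hlin : 2 * A - 2 * B = (t0 - t1) * p - 6 := by linear_combination hq0' - hq1'
  have hAB : 4 * (A * B) = γ * p ^ 2 + 2 * (t0 - t1) * p - 10 := by
    have : (2 * A - 2 * B) ^ 2 = ((t0 - t1) * p - 6) ^ 2 := by rw [hlin]
    rw [hγ]
    linear_combination (-1/2 : L) * this + 2 * hA2 + 2 * hB2 - (p ^ 2 / 2) * h0 - (p ^ 2 / 2) * h1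
  have hquart : (p ^ 2 + 6 * (t0 + t1) * p - 6 * γ) * ((p - 3 * (t0 + t1)) * (p + (t0 + t1))) = 0 := by
    have e : 16 * (A ^ 2 * B ^ 2) = (γ * p ^ 2 + 2 * (t0 - t1) * p - 10) ^ 2 := by rw [← hAB]; ring
    rw [hA2, hB2] at e
    have ht : (t0 + t1) ^ 2 = 2 * γ := by rw [hγ]; linear_combination h0 + h1
    have ht' : (t0 - t1) ^ 2 = -2 * γ := by rw [hγ]; linear_combination h0 + h1
    have e3 : t0 * t1 = γ := hγ.symm
    have e1 : (p ^ 2 + 6 * (t0 + t1) * p - 6 * γ) * ((p - 3 * (t0 + t1)) * (p + (t0 + t1)))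
      = p ^ 4 + 4 * (t0 + t1) * p ^ 3 - 36 * γ * p ^ 2 - 24 * (t0 - t1) * p - 36 := by
      linear_combination (-15 * p ^ 2 - 18 * (t0 + t1) * p + 18 * γ) * ht + 36 * hγ2
        - 24 * p * hγ0 - 24 * p * hγ1
    rw [e1]
    have e2 : (γ * p ^ 2 + 2 * (t0 - t1) * p - 10) ^ 2 =
      -p ^ 4 - 4 * (t0 + t1) * p ^ 3 - 28 * γ * p ^ 2 - 40 * (t0 - t1) * p + 100 := by
      linear_combination p ^ 4 * hγ2 + 4 * p ^ 2 * ht' + 4 * p ^ 3 * hγ0 - 4 * p ^ 3 * hγ1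
    rw [e2] at e
    linear_combination e + 64 * p ^ 2 * e3
  rcases mul_eq_zero.1 hquart with h | h
  · exfalso
    obtain ⟨g, hg⟩ := D.isSq_pm_i hγ2
    have hg0 : g ≠ 0 := by rintro rfl; rw [hg] at hγ2; norm_num at hγ2
    have hss := D.s_ne
    apply hL3 ((p + 3 * (t0 + t1)) / (2 * D.s * g))
    rw [div_pow, mul_pow, mul_pow, D.hs, ← hg, div_eq_iff (by rw [hg]; simp [hg0])]
    linear_combination h + 9 * h0 + 9 * h1 - 18 * hγ
  rcases mul_eq_zero.1 h with h | h
  · have hp : p = 3 * (t0 + t1) := by linear_combination h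
    have hA' : A = -3 + γ := by
      rw [hp] at hA2 hAB hlin
      have e : B = A + 6 := by linear_combination (-1/2 : L) * hlin + (-3/2 : L) * h0 + (3/2 : L) * h1
      rw [e] at hAB
      have e2 : A ^ 2 = 8 - 6 * γ := by rw [hA2, hγ]; linear_combination -6 * h0
      have e3 : 4 * (A * (A + 6)) = -40 := by
        rw [hAB]
        linear_combination 9 * γ * h0 + 9 * γ * h1 - 18 * γ * hγ + 18 * hγ2 + 6 * h0 - 6 * h1
      linear_combination (1/24 : L) * e3 - (1/6 : L) * e2
    obtain ⟨g, hg⟩ := D.isSq_pm_i hγ2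
    refine ⟨D.s * g, Or.inr (Or.inr ?_)⟩
    rw [mul_pow, D.hs, ← hg, hq0', hA', hp]
    linear_combination (9 - 12) * h0 + 9 * h1 - 6 * hγ
  · have hp : p = - (t0 + t1) := by linear_combination h
    have hA' : A = -1 - γ := by
      rw [hp] at hA2 hAB hlin
      have e : B = A + 2 := by linear_combination (-1/2 : L) * hlin + (1/2 : L) * h0 - (1/2 : L) * h1
      rw [e] at hAB
      have e2 : A ^ 2 = 2 * γ := by rw [hA2, hγ]; linear_combination 2 * h0
      have e3 : 4 * (A * (A + 2)) = -8 := by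
        rw [hAB]
        linear_combination γ * h0 + γ * h1 - 2 * γ * hγ + 2 * hγ2 - 2 * h0 + 2 * h1
      linear_combination (1/8 : L) * e3 - (1/2 : L) * e2
    refine ⟨t0 - t1, Or.inl ?_⟩
    rw [hq0', hA', hp]
    linear_combination 4 * h0 - 8 * hγ

end

section
variable {L : Type*} [Field L] [CharZero L]

/-- both of `U` type -/
theorem fq_case_UU (D : FQData_s2 L) (hL7 : ∀ b : L, b ^ 2 ≠ 7) {q t0 t1 s0 s1 m n ε w ε' w' : L}
    (hs0 : s0 ^ 2 = t0 ^ 3 - t0) (hs1 : s1 ^ 2 = t1 ^ 3 + t1)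
    (hp : m ^ 2 - t0 = n ^ 2 - t1)
    (hq0 : q * t0 = (s0 - m * t0) ^ 2) (hq1 : q * t1 = (s1 - n * t1) ^ 2)
    (hε : ε ^ 2 = 1) (hw : w ^ 2 = 2) (ht0 : t0 = ε * (1 + w))
    (hε' : ε' ^ 2 = 1) (hw' : w' ^ 2 = 2) (ht1 : t1 = D.i * ε' * (1 + w')) : q = 0 := by
  by_contra hq
  have hi := D.hi
  have hi0 := D.i_ne
  have hss := D.s_ne
  have h00 : t0 ≠ 0 := by
    intro h; rw [h] at ht0; exact D.U_not_sq hε hw 0 (by rw [← ht0]; ring)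
  have h10 : t1 ≠ 0 := by
    intro h; rw [h] at ht1; exact D.iU_not_sq hε' hw' 0 (by rw [← ht1]; ring)
  obtain ⟨e, he⟩ : ∃ e, s0 = e * t0 := ⟨s0 / t0, by field_simp⟩
  obtain ⟨f, hf⟩ : ∃ f, s1 = f * t1 := ⟨s1 / t1, by field_simp⟩
  have hU0 : t0 ^ 2 = 2 * ε * t0 + 1 := by
    rw [ht0]; linear_combination (w ^ 2 - 1) * hε + hw
  have hU1 : t1 ^ 2 = 2 * D.i * ε' * t1 - 1 := by
    rw [ht1]; linear_combination (w' ^ 2 - 1) * (ε' ^ 2 * hi - hε') - hw'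
  have he2 : e ^ 2 = 2 * ε := by
    have : t0 ^ 2 * (e ^ 2 - 2 * ε) = 0 := by
      rw [he] at hs0; linear_combination hs0 + t0 * hU0
    have := (mul_eq_zero.1 this).resolve_left (pow_ne_zero _ h00)
    linear_combination this
  have hf2 : f ^ 2 = 2 * D.i * ε' := by
    have : t1 ^ 2 * (f ^ 2 - 2 * D.i * ε') = 0 := by
      rw [hf] at hs1; linear_combination hs1 + t1 * hU1
    have := (mul_eq_zero.1 this).resolve_left (pow_ne_zero _ h10)
    linear_combination this
  have hq0' : q = t0 * (e - m) ^ 2 := by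
    apply mul_right_cancel₀ h00; rw [hq0, he]; ring
  have hq1' : q = t1 * (f - n) ^ 2 := by
    apply mul_right_cancel₀ h10; rw [hq1, hf]; ring
  have hem : e - m ≠ 0 := by
    intro h; apply hq; rw [hq0', h]; ring
  obtain ⟨c, hc⟩ : ∃ c, f - n = c * (e - m) := ⟨(f - n) / (e - m), by field_simp⟩
  have hct : t0 = c ^ 2 * t1 := by
    apply mul_right_cancel₀ (pow_ne_zero 2 hem)
    rw [← hq0', hq1', hc]; ring
  obtain ⟨g, hg⟩ : ∃ g, g = f - c * e := ⟨_, rfl⟩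
  have hn : n = g + c * m := by rw [hg]; linear_combination -hc
  obtain ⟨X, hX⟩ : ∃ X, X = (1 - c ^ 2) * m - g * c := ⟨_, rfl⟩
  have hX2 : X ^ 2 = g ^ 2 + (1 - c ^ 2) * (t0 - t1) := by
    rw [hn] at hp; rw [hX]; linear_combination (1 - c ^ 2) * hp
  have hww : (w' - w) * (w' + w) = 0 := by linear_combination hw' - hw
  have hεε : (ε' - ε) * (ε' + ε) = 0 := by linear_combination hε' - hε
  rcases mul_eq_zero.1 hww with h | h
  · have hw'' : w' = w := by linear_combination h
    subst hw''
    have ht : t1 = D.i * ε * ε' * t0 := by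
      rw [ht0, ht1]; linear_combination (-D.i * ε' * (1 + w')) * hε
    have hc2 : c ^ 2 = - D.i * ε * ε' := by
      have : t0 * (c ^ 2 * (D.i * ε * ε') - 1) = 0 := by
        rw [ht] at hct; linear_combination -hct
      have := (mul_eq_zero.1 this).resolve_left h00
      linear_combination (-D.i * ε * ε') * this + c ^ 2 * (ε ^ 2 * ε' ^ 2 * hi - ε' ^ 2 * hε - hε')
    have hce : (c * e - D.i * f) * (c * e + D.i * f) = 0 := by
      linear_combination e ^ 2 * hc2 - D.i * ε * ε' * he2 - f ^ 2 * hi + hf2 - 2 * D.i * ε' * hε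
    have hXs : ∀ k : L, (k = 1 ∨ k = -1 ∨ k = 3 ∨ k = -3) → X ^ 2 ≠ 2 * (k + ε * w') := by
      intro k hk hX'
      refine D.kw_not_sq hL7 (w := ε * w') (k := k) (by rw [mul_pow, hε, hw]; ring) hk (X / D.s) ?_
      rw [div_pow, D.hs, hX']; ring
    have hval : (1 - c ^ 2) * (t0 - t1) = 2 * ε * (1 + w') := by
      rw [hc2, ht]
      have : (D.i * ε * ε') ^ 2 = -1 := by rw [mul_pow, mul_pow, hi, hε, hε']; ring
      linear_combination -t0 * this + 2 * ht0
    have h1 : ε = 1 ∨ ε = -1 := by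
      rcases sq_eq_sq_iff_eq_or_eq_neg.1 (show _ ^ 2 = (1 : L) ^ 2 by rw [hε]; ring) with h | h
      exacts [Or.inl h, Or.inr h]
    have h2 : ε' = 1 ∨ ε' = -1 := by
      rcases sq_eq_sq_iff_eq_or_eq_neg.1 (show _ ^ 2 = (1 : L) ^ 2 by rw [hε']; ring) with h | h
      exacts [Or.inl h, Or.inr h]
    have hg2 : g ^ 2 = 4 * ε' ∨ g ^ 2 = - 4 * ε' := by
      rcases mul_eq_zero.1 hce with h | h
      · left
        rw [hg, show c * e = D.i * f by linear_combination h]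
        linear_combination f ^ 2 * hi - 2 * D.i * hf2 - 4 * ε' * hi
      · right
        rw [hg, show c * e = - (D.i * f) by linear_combination h]
        linear_combination f ^ 2 * hi + 2 * D.i * hf2 + 4 * ε' * hi
    have hg3 : g ^ 2 = 4 ∨ g ^ 2 = -4 := by
      rcases h2 with h2 | h2 <;> rcases hg2 with h | h <;> rw [h, h2] <;> norm_num
    rw [hval] at hX2
    rcases hg3 with h3 | h3 <;> rcases h1 with h1 | h1
    · exact hXs 3 (by simp) (by rw [hX2, h3, h1]; ring)
    · exact hXs 1 (by simp) (by rw [hX2, h3, h1]; ring)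
    · exact hXs (-1) (by simp) (by rw [hX2, h3, h1]; ring)
    · exact hXs (-3) (by simp) (by rw [hX2, h3, h1]; ring)
  · have hw'' : w' = -w := by linear_combination h
    subst hw''
    have ht : t1 * t0 = - D.i * ε * ε' := by
      rw [ht0, ht1]; linear_combination (-D.i * ε * ε') * hw
    have hc2 : c ^ 2 = D.i * ε * ε' * t0 ^ 2 := by
      have : t0 ^ 2 = c ^ 2 * (- D.i * ε * ε') := by
        rw [← ht]; linear_combination t0 * hct
      rw [this]
      linear_combination c ^ 2 * (ε ^ 2 * ε' ^ 2 * hi - ε' ^ 2 * hε - hε')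
    have hce : (c * e - f * t0) * (c * e + f * t0) = 0 := by
      linear_combination e ^ 2 * hc2 + D.i * ε * ε' * t0 ^ 2 * he2 - t0 ^ 2 * hf2
        + 2 * D.i * ε' * t0 ^ 2 * hε
    have h5 : ∀ k : L, k = ε' ∨ k = -ε' → X ^ 2 ≠ 2 * t0 * (1 + 2 * k * D.i) := by
      intro k hk hX'
      have hk2 : k ^ 2 = 1 := by rcases hk with h | h <;> rw [h] <;> linear_combination hε'
      have hσ : (D.σ X) ^ 2 = 2 * t0 * (1 - 2 * k * D.i) := by
        rw [← map_pow, hX', ht0]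
        simp only [map_mul, map_add, map_one, (D.tau_w hw).2, (D.sig_eps hε).2,
          (D.sig_eps hk2).2, D.σi, map_ofNat]
        ring
      apply D.five_not_sq (X * D.σ X / (2 * t0))
      rw [div_pow, mul_pow, hX', hσ]
      field_simp
      linear_combination -4 * k ^ 2 * hi + 4 * hk2
    have ht1' : t1 = - D.i * ε * ε' * (t0 - 2 * ε) := by
      apply mul_right_cancel₀ h00; rw [ht]; linear_combination (D.i * ε * ε') * hU0
    have hval : (1 - c ^ 2) * (t0 - t1) = 2 * t0 - 2 * D.i * ε' * (1 + t0 ^ 2) := by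
      have e1 : (1 - c ^ 2) * (t0 - t1) = 2 * t0 - t1 - c ^ 2 * t0 := by linear_combination -hct
      rw [e1, hc2, ht1']
      linear_combination (-D.i * ε * ε' * t0) * hU0 - (2 * D.i * ε' * (1 + t0 ^ 2)) * hε
    rw [hval] at hX2
    rcases mul_eq_zero.1 hce with h | h
    · apply h5 (-ε') (by simp)
      rw [hX2, hg, show c * e = f * t0 by linear_combination h]
      linear_combination (1 - t0) ^ 2 * hf2
    · apply h5 ε' (by simp)
      rw [hX2, hg, show c * e = - (f * t0) by linear_combination h]
      linear_combination (1 + t0) ^ 2 * hf2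

theorem fq_combine (D : FQData_s2 L) (hL3 : ∀ b : L, b ^ 2 ≠ 3) (hL7 : ∀ b : L, b ^ 2 ≠ 7)
    {p q t0 t1 s0 s1 m n : L}
    (hs0 : s0 ^ 2 = t0 ^ 3 - t0) (hs1 : s1 ^ 2 = t1 ^ 3 + t1)
    (hp0 : p = m ^ 2 - t0) (hp1 : p = n ^ 2 - t1)
    (hq0 : q = t0 ^ 2 - 1 - 2 * s0 * m + m ^ 2 * t0)
    (hq1 : q = t1 ^ 2 + 1 - 2 * s1 * n + n ^ 2 * t1) : FQConc p q := by
  have hqt0 : q * t0 = (s0 - m * t0) ^ 2 := by rw [hq0]; linear_combination -hs0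
  have hqt1 : q * t1 = (s1 - n * t1) ^ 2 := by rw [hq1]; linear_combination -hs1
  have hp : m ^ 2 - t0 = n ^ 2 - t1 := by rw [← hp0, hp1]
  -- a common square criterion
  have key : ∀ t a g : L, t ≠ 0 → q * t = a ^ 2 → t = g ^ 2 → ∃ r, q = r ^ 2 := by
    intro t a g ht h1 h2
    have hg : g ≠ 0 := by rintro rfl; exact ht (by rw [h2]; ring)
    exact ⟨a / g, by rw [div_pow, ← h1, h2]; field_simp⟩
  have key2 : ∀ t a : L, q * t = a ^ 2 → (∀ z : L, z ^ 2 ≠ t) → (∃ r, q = r ^ 2) → q = 0 := by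
    rintro t a h1 h2 ⟨r, hr⟩
    by_contra hq
    have hr0 : r ≠ 0 := by rintro rfl; exact hq (by rw [hr]; ring)
    apply h2 (a / r)
    rw [div_pow, ← h1, hr]; field_simp
  have A0 : ((t0 = 0 ∨ t0 ^ 2 = 1) ∧ s0 = 0) ∨ t0 ^ 2 = -1 ∨
      ∃ ε w : L, ε ^ 2 = 1 ∧ w ^ 2 = 2 ∧ t0 = ε * (1 + w) := by
    rcases fqE_points'' D hs0 with h | h
    · left
      refine ⟨?_, h⟩
      rw [h] at hs0
      have : t0 * (t0 ^ 2 - 1) = 0 := by linear_combination -hs0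
      rcases mul_eq_zero.1 this with h | h
      · exact Or.inl h
      · right; linear_combination h
    · exact Or.inr h
  have A1 : ((t1 = 0 ∨ t1 ^ 2 = -1) ∧ s1 = 0) ∨ t1 ^ 2 = 1 ∨
      ∃ ε w : L, ε ^ 2 = 1 ∧ w ^ 2 = 2 ∧ t1 = D.i * ε * (1 + w) := by
    rcases fqE_points' D hs1 with h | h
    · left
      refine ⟨?_, h⟩
      rw [h] at hs1
      have : t1 * (t1 ^ 2 + 1) = 0 := by linear_combination -hs1
      rcases mul_eq_zero.1 this with h | h
      · exact Or.inl h
      · right; linear_combination h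
    · exact Or.inr h
  have hne1 : ∀ {t c : L}, c ≠ 0 → t ^ 2 = c → t ≠ 0 := by
    rintro t c hc h rfl; exact hc (by rw [← h]; ring)
  have B0 : ((t0 = 0 ∨ t0 ^ 2 = 1) ∧ s0 = 0) ∨ t0 ^ 2 = -1 → ∃ r, q = r ^ 2 := by
    rintro (⟨h | h, h'⟩ | h)
    · exact ⟨D.i, by rw [hq0, h, h', D.hi]; ring⟩
    · obtain ⟨g, hg⟩ := D.isSq_pm_one h
      exact key _ _ g (hne1 one_ne_zero h) hqt0 hg
    · obtain ⟨g, hg⟩ := D.isSq_pm_i h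
      exact key _ _ g (hne1 (by norm_num) h) hqt0 hg
  have B1 : ((t1 = 0 ∨ t1 ^ 2 = -1) ∧ s1 = 0) ∨ t1 ^ 2 = 1 → ∃ r, q = r ^ 2 := by
    rintro (⟨h | h, h'⟩ | h)
    · exact ⟨1, by rw [hq1, h, h']; ring⟩
    · obtain ⟨g, hg⟩ := D.isSq_pm_i h
      exact key _ _ g (hne1 (by norm_num) h) hqt1 hg
    · obtain ⟨g, hg⟩ := D.isSq_pm_one h
      exact key _ _ g (hne1 one_ne_zero h) hqt1 hg
  rcases or_assoc.2 A0 with a0 | ⟨ε, w, h1, h2, h3⟩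
  · rcases or_assoc.2 A1 with a1 | ⟨ε', w', h1', h2', h3'⟩
    · rcases a0 with ⟨h0, h0'⟩ | h0 <;> rcases a1 with ⟨h1, h1'⟩ | h1
      · subst h0' h1'
        exact fq_case_a D h0 h1 hp0 hp1 (by rw [hq0]; ring) (by rw [hq1]; ring)
      · subst h0'
        exact fq_case_b D h0 h1 hs1 hp0 hp1 (by rw [hq0]; ring) hq1
      · subst h1'
        exact fq_case_c D h0 h1 hs0 hp0 hp1 hq0 (by rw [hq1]; ring)
      · exact fq_case_d D hL3 h0 h1 hs0 hs1 hp0 hp1 hq0 hq1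
    · apply FQConc.of_zero
      exact key2 _ _ hqt1 (fun z => h3' ▸ D.iU_not_sq h1' h2' z) (B0 a0)
  · apply FQConc.of_zero
    rcases or_assoc.2 A1 with a1 | ⟨ε', w', h1', h2', h3'⟩
    · exact key2 _ _ hqt0 (fun z => h3 ▸ D.U_not_sq h1 h2 z) (B1 a1)
    · exact fq_case_UU D hL7 hs0 hs1 hp hqt0 hqt1 h1 h2 h3 h1' h2' h3'

end

section
variable {L K : Type*} [Field L] [CharZero L] [Field K] [Algebra L K]

theorem fq_basis (h : Module.finrank L K = 2) {t : K} (ht : ∀ a : L, algebraMap L K a ≠ t) (y : K) :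
    ∃ a b : L, y = algebraMap L K a + algebraMap L K b * t := by
  have hli : LinearIndependent L ![(1 : K), t] := by
    rw [LinearIndependent.pair_iff' one_ne_zero]
    intro a ha
    exact ht a (by rw [← ha, Algebra.smul_def, mul_one])
  have : FiniteDimensional L K := Module.finite_of_finrank_pos (by omega)
  have hsp := hli.span_eq_top_of_card_eq_finrank' (by simp [h])
  have hy : y ∈ Submodule.span L (Set.range ![(1 : K), t]) := by rw [hsp]; trivial
  simp only [Matrix.range_cons, Matrix.range_empty, Set.union_empty, Set.singleton_union] at hy
  obtain ⟨a, b, hab⟩ := Submodule.mem_span_pair.1 hy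
  refine ⟨a, b, ?_⟩
  rw [← hab, Algebra.smul_def, Algebra.smul_def, mul_one]

theorem fq_indep {t : K} (ht : ∀ a : L, algebraMap L K a ≠ t) {a b : L}
    (h : algebraMap L K a + algebraMap L K b * t = 0) : a = 0 ∧ b = 0 := by
  have hb : b = 0 := by
    by_contra hb
    have hb' : algebraMap L K b ≠ 0 := by simpa using hb
    apply ht (-a / b)
    rw [map_div₀, map_neg]
    field_simp
    linear_combination -h
  subst hb
  simp at h
  exact ⟨h, rfl⟩

theorem fq_core (D : FQData_s2 L) (hr : Module.finrank L K = 2)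
    (hs : ∀ z : K, z ^ 2 ≠ algebraMap L K D.s) (hs' : ∀ z : K, z ^ 2 ≠ - algebraMap L K D.s)
    (h24 : ∀ z : K, z ^ 4 ≠ 2) (h3 : ∀ z : K, z ^ 2 ≠ 3) (h7 : ∀ z : K, z ^ 2 ≠ 7)
    {t y1 y2 : K} (h1 : y1 ^ 2 = t ^ 3 - t) (h2 : y2 ^ 2 = t ^ 3 + t) : y1 * y2 = 0 := by
  have hinj : Function.Injective (algebraMap L K) := (algebraMap L K).injective
  have : CharZero K := charZero_of_injective_algebraMap hinj
  set φ := algebraMap L K with hφ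
  have hw : ∀ ε w : L, ε ^ 2 = 1 → w ^ 2 = 2 → ∀ z : K, z ^ 2 ≠ φ (ε * w) := by
    intro ε w h h' z hz
    rcases D.sq_eq_two (show (ε * w) ^ 2 = 2 by rw [mul_pow, h, h']; ring) with h4 | h4
    · exact hs z (by rw [hz, h4])
    · exact hs' z (by rw [hz, h4, map_neg])
  have hsd : (φ D.s) ^ 2 = 2 := by rw [← map_pow, D.hs, map_ofNat]
  have hid : (φ D.i) ^ 2 = -1 := by rw [← map_pow, D.hi, map_neg, map_one]
  have hsd0 : φ D.s ≠ 0 := by simpa using D.s_ne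
  by_cases htL : ∀ a : L, φ a ≠ t
  · exfalso
    obtain ⟨q', p, ht2⟩ := fq_basis hr htL (t ^ 2)
    obtain ⟨q, rfl⟩ : ∃ q, q' = -q := ⟨-q', by ring⟩
    obtain ⟨a, m, hy1⟩ := fq_basis hr htL y1
    obtain ⟨b, n, hy2⟩ := fq_basis hr htL y2
    rw [← hφ] at ht2 hy1 hy2
    rw [map_neg] at ht2
    have e1 : φ (-p * q - a ^ 2 + m ^ 2 * q) + φ (p ^ 2 - q - 1 - 2 * a * m - m ^ 2 * p) * t = 0 := by
      simp only [map_sub, map_add, map_mul, map_neg, map_pow, map_one, map_ofNat]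
      rw [hy1] at h1
      linear_combination -h1 - (t + φ p - φ m ^ 2) * ht2
    have e2 : φ (-p * q - b ^ 2 + n ^ 2 * q) + φ (p ^ 2 - q + 1 - 2 * b * n - n ^ 2 * p) * t = 0 := by
      simp only [map_sub, map_add, map_mul, map_neg, map_pow, map_one, map_ofNat]
      rw [hy2] at h2
      linear_combination -h2 - (t + φ p - φ n ^ 2) * ht2
    obtain ⟨e3, e4⟩ := fq_indep htL e1
    obtain ⟨e5, e6⟩ := fq_indep htL e2
    have hL3 : ∀ z : L, z ^ 2 ≠ 3 := fun z hz => h3 (φ z) (by rw [← map_pow, hz, map_ofNat])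
    have hL7 : ∀ z : L, z ^ 2 ≠ 7 := fun z hz => h7 (φ z) (by rw [← map_pow, hz, map_ofNat])
    obtain ⟨c, hc⟩ := fq_combine D hL3 hL7 (p := p) (q := q) (t0 := m ^ 2 - p) (t1 := n ^ 2 - p)
      (s0 := a + m * (m ^ 2 - p)) (s1 := b + n * (n ^ 2 - p)) (m := m) (n := n)
      (by linear_combination -e3 - (m ^ 2 - p) * e4) (by linear_combination -e5 - (n ^ 2 - p) * e6)
      (by ring) (by ring) (by linear_combination -e4) (by linear_combination -e6)
    have hd : (2 * t - φ p) ^ 2 = φ (p ^ 2 - 4 * q) := by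
      simp only [map_sub, map_mul, map_pow, map_ofNat]
      linear_combination 4 * ht2
    have hnz : 2 * t - φ p ≠ 0 := by
      intro h
      apply htL (p / 2)
      rw [map_div₀, map_ofNat]; linear_combination (-1/2 : K) * h
    have hroot : ∀ k : K, (∀ z : K, z ^ 2 ≠ k) → φ (p ^ 2 - 4 * q) = k * φ c ^ 2 → False := by
      intro k hk h
      have hc0 : φ c ≠ 0 := by
        intro h0; apply hnz
        have : (2 * t - φ p) ^ 2 = 0 := by rw [hd, h, h0]; ring
        exact pow_eq_zero_iff two_ne_zero |>.1 this
      apply hk ((2 * t - φ p) / φ c)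
      rw [div_pow, hd, h]; field_simp
    rcases hc with hc | hc | hc
    · have : (2 * t - φ p - φ c) * (2 * t - φ p + φ c) = 0 := by
        rw [hc, map_pow] at hd; linear_combination hd
      rcases mul_eq_zero.1 this with h | h
      · apply htL ((p + c) / 2)
        rw [map_div₀, map_ofNat, map_add]; linear_combination (-1/2 : K) * h
      · apply htL ((p - c) / 2)
        rw [map_div₀, map_ofNat, map_sub]; linear_combination (-1/2 : K) * h
    · exact hroot 3 h3 (by rw [hc, map_mul, map_pow, map_ofNat])
    · exact hroot 7 h7 (by rw [hc, map_mul, map_pow, map_ofNat])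
  · push Not at htL
    obtain ⟨T, rfl⟩ := htL
    by_cases hy1 : ∃ a : L, φ a = y1
    · obtain ⟨a, rfl⟩ := hy1
      have h1' : a ^ 2 = T ^ 3 - T := by
        apply hinj; simp only [map_sub, map_pow]; exact h1
      rcases fqE_points'' D h1' with h | h | ⟨ε, w, e1, e2, e3⟩
      · rw [h]; simp
      · have : y2 ^ 2 = 0 := by
          rw [h2]
          have : φ (T ^ 3 + T) = 0 := by
            rw [show T ^ 3 + T = 0 by linear_combination T * h]; simp
          rw [← this]; simp
        rw [pow_eq_zero_iff two_ne_zero |>.1 this]; simp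
      · exfalso
        have hnz : 1 + w ≠ 0 := by
          intro h; exact D.U_not_sq e1 e2 0 (by rw [h]; ring)
        have hnz' : φ (1 + w) ≠ 0 := (map_ne_zero φ).2 hnz
        apply hw ε w e1 e2 (y2 / (φ D.s * φ (1 + w)))
        rw [div_pow, mul_pow, hsd, div_eq_iff (mul_ne_zero two_ne_zero (pow_ne_zero _ hnz'))]
        rw [h2, ← map_pow, ← map_ofNat φ 2, ← map_pow, ← map_mul, ← map_mul, ← map_add]
        congr 1
        rw [e3]
        linear_combination (ε * (1 + w) ^ 3) * e1 - ε * (1 + w) * e2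
    by_cases hy2 : ∃ a : L, φ a = y2
    · obtain ⟨a, rfl⟩ := hy2
      have h2' : a ^ 2 = T ^ 3 + T := by
        apply hinj; simp only [map_add, map_pow]; exact h2
      rcases fqE_points' D h2' with h | h | ⟨ε, w, e1, e2, e3⟩
      · rw [h]; simp
      · have : y1 ^ 2 = 0 := by
          rw [h1]
          have : φ (T ^ 3 - T) = 0 := by
            rw [show T ^ 3 - T = 0 by linear_combination T * h]; simp
          rw [← this]; simp
        rw [pow_eq_zero_iff two_ne_zero |>.1 this]; simp
      · exfalso
        have hnz : 1 + w ≠ 0 := by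
          intro h; exact D.U_not_sq e1 e2 0 (by rw [h]; ring)
        have hnz' : φ (1 + w) ≠ 0 := (map_ne_zero φ).2 hnz
        have hnz2 : φ (1 - D.i) ≠ 0 := by
          intro h
          have : D.i = 1 := by
            have := (map_eq_zero φ).1 h; linear_combination -this
          have h4 := D.hi; rw [this] at h4; norm_num at h4
        apply hw ε w e1 e2 (y1 / (φ (1 - D.i) * φ (1 + w)))
        rw [div_pow, mul_pow, div_eq_iff (mul_ne_zero (pow_ne_zero _ hnz2) (pow_ne_zero _ hnz'))]
        rw [h1, ← map_pow, ← map_pow, ← map_pow, ← map_mul, ← map_mul, ← map_sub]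
        congr 1
        rw [e3]
        have hi := D.hi
        linear_combination D.i * ε * (1 + w) ^ 3 * (ε ^ 2 * hi - e1) - ε * w * (1 + w) ^ 2 * hi
          + D.i * ε * (1 + w) * e2
    · exfalso
      push Not at hy1 hy2
      have hy10 : y1 ≠ 0 := fun h => hy1 0 (by rw [h]; simp)
      obtain ⟨a, b, hab⟩ := fq_basis hr hy1 y2
      rw [← hφ] at hab
      have e : φ (a ^ 2 + b ^ 2 * (T ^ 3 - T) - (T ^ 3 + T)) + φ (2 * a * b) * y1 = 0 := by
        simp only [map_sub, map_add, map_mul, map_pow, map_ofNat]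
        rw [hab] at h2
        linear_combination h2 - φ b ^ 2 * h1
      obtain ⟨-, e2⟩ := fq_indep hy1 e
      have hb : b ≠ 0 := by
        intro h; apply hy2 a; rw [hab, h]; simp
      have ha : a = 0 := by
        by_contra ha; simp [ha, hb] at e2
      have hP : φ (b * (T ^ 3 - T)) = y1 * y2 := by
        rw [hab, ha]; simp only [map_sub, map_mul, map_pow, map_zero]; linear_combination -φ b * h1
      have hE : (b * (T ^ 3 - T)) ^ 2 = (T ^ 2) ^ 3 - T ^ 2 := by
        apply hinj
        rw [map_pow, hP, mul_pow, h1, h2]; simp only [map_sub, map_pow]; ring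
      rcases fqE_points'' D hE with h | h | ⟨ε, w, e1, e2, e3⟩
      · rw [h, map_zero] at hP
        rcases mul_eq_zero.1 hP.symm with h | h
        · exact hy10 h
        · exact hy2 0 (by rw [h]; simp)
      · apply h24 y1
        have h' : φ T ^ 4 = -1 := by
          rw [← map_pow, show T ^ 4 = -1 by linear_combination h]; simp
        linear_combination (y1 ^ 2 + φ T ^ 3 - φ T) * h1 + (φ T ^ 2 - 2) * h'
      · exact D.U_not_sq e1 e2 T e3
end

theorem fq_exists_data (L : Type*) [Field L] [CharZero L] [Algebra ℚ L]
    [IsCyclotomicExtension {8} ℚ L] : Nonempty (FQData_s2 L) := by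
  have hζ : IsPrimitiveRoot (IsCyclotomicExtension.zeta 8 ℚ L) 8 := IsCyclotomicExtension.zeta_spec 8 ℚ L
  have hirr : Irreducible (Polynomial.cyclotomic 8 ℚ) := Polynomial.cyclotomic.irreducible_rat (by norm_num)
  have hs7 := IsCyclotomicExtension.fromZetaAut_spec (hζ.pow_of_coprime 7 (by norm_num)) hirr
  have hs5 := IsCyclotomicExtension.fromZetaAut_spec (hζ.pow_of_coprime 5 (by norm_num)) hirr
  generalize IsCyclotomicExtension.fromZetaAut (hζ.pow_of_coprime 7 (by norm_num)) hirr = σ at hs7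
  generalize IsCyclotomicExtension.fromZetaAut (hζ.pow_of_coprime 5 (by norm_num)) hirr = τ at hs5
  have htop := IsCyclotomicExtension.adjoin_primitive_root_eq_top (A := ℚ) hζ
  generalize IsCyclotomicExtension.zeta 8 ℚ L = ζ at *
  have h4 : ζ ^ 4 = -1 := by
    have h8 := hζ.pow_eq_one
    have h4 : ζ ^ 4 ≠ 1 := hζ.pow_ne_one_of_pos_of_lt (by norm_num) (by norm_num)
    have : (ζ ^ 4 - 1) * (ζ ^ 4 + 1) = 0 := by linear_combination h8
    rcases mul_eq_zero.1 this with h | h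
    · exact absurd (by linear_combination h) h4
    · linear_combination h
  have hσ : σ ζ = - ζ ^ 3 := by rw [hs7]; linear_combination ζ ^ 3 * h4
  have hτ : τ ζ = - ζ := by rw [hs5]; linear_combination ζ * h4
  have hrep : ∀ x : L, ∃ a b c d : ℚ, x = a + b * ζ + c * ζ ^ 2 + d * ζ ^ 3 := by
    intro x
    have hx : x ∈ Algebra.adjoin ℚ {ζ} := by rw [htop]; trivial
    induction hx using Algebra.adjoin_induction with
    | mem x hx =>
      rw [Set.mem_singleton_iff] at hx
      exact ⟨0, 1, 0, 0, by rw [hx]; push_cast; ring⟩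
    | algebraMap r => exact ⟨r, 0, 0, 0, by simp⟩
    | add x y _ _ hx hy =>
      obtain ⟨a, b, c, d, rfl⟩ := hx
      obtain ⟨a', b', c', d', rfl⟩ := hy
      exact ⟨a + a', b + b', c + c', d + d', by push_cast; ring⟩
    | mul x y _ _ hx hy =>
      obtain ⟨a, b, c, d, rfl⟩ := hx
      obtain ⟨a', b', c', d', rfl⟩ := hy
      refine ⟨a * a' - b * d' - c * c' - d * b', a * b' + b * a' - c * d' - d * c',
        a * c' + b * b' + c * a' - d * d', a * d' + b * c' + c * b' + d * a', ?_⟩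
      push_cast
      linear_combination ((b * d' + c * c' + d * b') + (c * d' + d * c') * ζ + d * d' * ζ ^ 2 : L) * h4
  refine ⟨⟨ζ ^ 2, ζ - ζ ^ 3, (σ : L →+* L), (τ : L →+* L), ?_, ?_, ?_, ?_, ?_, ?_, ?_, ?_, ?_, ?_⟩⟩
  · linear_combination h4
  · linear_combination (ζ ^ 2 - 2) * h4
  · simp [hσ]; linear_combination ζ ^ 2 * h4
  · simp [hσ]; linear_combination ζ * (ζ ^ 4 - 1) * h4
  · simp [hτ]
  · simp [hτ]; ring
  · intro x
    obtain ⟨a, b, c, d, rfl⟩ := hrep x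
    have : σ (σ ζ) = ζ := by
      rw [hσ, map_neg, map_pow, hσ]; linear_combination ζ * (ζ ^ 4 - 1) * h4
    simp [this]
  · intro x
    obtain ⟨a, b, c, d, rfl⟩ := hrep x
    have : τ (τ ζ) = ζ := by rw [hτ, map_neg, hτ]; ring
    simp [this]
  · intro x
    obtain ⟨a, b, c, d, rfl⟩ := hrep x
    have : σ (τ ζ) = τ (σ ζ) := by simp [hσ, hτ]; ring
    simp [this]
  · intro x
    obtain ⟨a, b, c, d, rfl⟩ := hrep x
    intro h1 h2
    refine ⟨a, ?_⟩
    simp [hσ] at h1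
    simp [hτ] at h2
    have e2 : (b * ζ + d * ζ ^ 3 : L) = 0 := by linear_combination (-1/2 : L) * h2
    have e1 : (c * ζ ^ 2 : L) = 0 := by
      have e3 := congrArg σ e2
      simp [hσ] at e3
      linear_combination (-1/2 : L) * (h1 - e3 + e2) + (c * ζ ^ 2 / 2 : L) * h4
    linear_combination e1 + e2

theorem fq_final (L K : Type*) [Field L] [CharZero L] [Algebra ℚ L] [IsCyclotomicExtension {8} ℚ L]
    [Field K] [CharZero K] [Algebra ℚ K] [Algebra L K] [IsScalarTower ℚ L K]
    (hdim : Module.finrank ℚ K = 8) (h2 : ¬ ∃ x : K, x ^ 4 = 2)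
    (h3 : ¬ ∃ x : K, x ^ 2 + x + 1 = 0) (h7 : ¬ ∃ x : K, x ^ 2 = -7) (x y z : K)
    (h : x ^ 4 + y ^ 4 = z ^ 4) : x * y * z = 0 := by
  have hirr : Irreducible (Polynomial.cyclotomic 8 ℚ) := Polynomial.cyclotomic.irreducible_rat (by norm_num)
  have hfin : Module.finrank ℚ L = 4 := by
    rw [IsCyclotomicExtension.finrank L hirr]; decide
  have hr : Module.finrank L K = 2 := by
    have := Module.finrank_mul_finrank ℚ L K
    rw [hfin, hdim] at this; omega
  obtain ⟨D⟩ := fq_exists_data L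
  have hi : (algebraMap L K D.i) ^ 2 = -1 := by rw [← map_pow, D.hi, map_neg, map_one]
  have hs : (algebraMap L K D.s) ^ 2 = 2 := by rw [← map_pow, D.hs, map_ofNat]
  have hs0 : algebraMap L K D.s ≠ 0 := by
    intro h0; rw [h0] at hs; norm_num at hs
  have hi0 : algebraMap L K D.i ≠ 0 := by
    intro h0; rw [h0] at hi; norm_num at hi
  have core : ∀ t y1 y2 : K, y1 ^ 2 = t ^ 3 - t → y2 ^ 2 = t ^ 3 + t → y1 * y2 = 0 :=
    fun t y1 y2 => fq_core (K := K) D hr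
    (fun z hz => h2 ⟨z, by linear_combination (z ^ 2 + algebraMap L K D.s) * hz + hs⟩)
    (fun z hz => h2 ⟨z, by linear_combination (z ^ 2 - algebraMap L K D.s) * hz + hs⟩)
    (fun z hz => h2 ⟨z, hz⟩)
    (fun z hz => h3 ⟨(-1 + algebraMap L K D.i * z) / 2, by
      linear_combination (1/4 : K) * (z ^ 2 * hi - hz)⟩)
    (fun z hz => h7 ⟨algebraMap L K D.i * z, by linear_combination z ^ 2 * hi - hz⟩)
  generalize algebraMap L K D.i = i at *
  generalize algebraMap L K D.s = s at *
  by_contra hne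
  have hx : x ≠ 0 := by rintro rfl; simp at hne
  have hy : y ≠ 0 := by rintro rfl; simp at hne
  have hz : z ≠ 0 := by rintro rfl; simp at hne
  have hxz : z ^ 2 - x ^ 2 ≠ 0 := by
    intro h0
    have : y ^ 4 = 0 := by linear_combination h + (z ^ 2 + x ^ 2) * h0
    exact hy (pow_eq_zero_iff (by norm_num) |>.1 this)
  have := core ((z ^ 2 - x ^ 2) / y ^ 2) (i * s * x * (z ^ 2 - x ^ 2) / y ^ 3)
    (s * z * (z ^ 2 - x ^ 2) / y ^ 3)
    (by
      field_simp
      linear_combination (z ^ 2 - x ^ 2) * (s ^ 2 * x ^ 2 * hi - x ^ 2 * hs) + h)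
    (by
      field_simp
      linear_combination (z ^ 2 - x ^ 2) * z ^ 2 * hs - h)
  have h1 : i * s * x * (z ^ 2 - x ^ 2) / y ^ 3 ≠ 0 := by simp [*]
  have h2 : s * z * (z ^ 2 - x ^ 2) / y ^ 3 ≠ 0 := by simp [*]
  exact mul_ne_zero h1 h2 this

theorem fermat_quartic_quadratic_extension_cuspidal (K : Type*) [Field K] [CharZero K] [Algebra ℚ K] (hζ : ∃ ζ : K, IsPrimitiveRoot ζ 8) (hdim : Module.finrank ℚ K = 8) (h2 : ¬ ∃ x : K, x ^ 4 = 2) (h3 : ¬ ∃ x : K, x ^ 2 + x + 1 = 0) (h7 : ¬ ∃ x : K, x ^ 2 = -7) (x y z : K) (h : x ^ 4 + y ^ 4 = z ^ 4) : x * y * z = 0 := by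
  obtain ⟨ζ, hζ⟩ := hζ
  have : FiniteDimensional ℚ K := Module.finite_of_finrank_pos (by omega)
  have hcyc := hζ.intermediateField_adjoin_isCyclotomicExtension ℚ
  exact @fq_final (IntermediateField.adjoin ℚ {ζ}) K _ _ (IntermediateField.algebra' _) hcyc _ _ _ _
    (IntermediateField.isScalarTower_mid' _) hdim h2 h3 h7 x y z h
end
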